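/- arXiv:1909.11526 — 5 statements merged into one kernel-verified Lean document; each statement's English description precedes it below -/
import Mathlib

section
/- Let G be a nonempty open subset of the upper half-plane H, let α ≥ 0, γ ≥ α, 0 < d ≤ 1 and e ≥ 1, and define C_c(G) := inf over nonzero smooth v with compact support in G of the sup over nonzero smooth ψ with compact support in G of F[v,ψ;G], where F[v,ψ;G] := (∫_G (∂_x v ∂_x ψ + ∂_y v ∂_y ψ) y^{-α} dx dy) / (‖∇_d v‖_{α+γ} · ‖∇_e ψ‖_{α−γ}) and ‖∇_c f‖_β² := ∫_G (c²(∂_x f)² + (∂_y f)²) y^{-β} dx dy. Then 0 ≤ C_c(G) ≤ 1. Moreover, if γ = 0 (with any α ≥ 0) and additionally e²d² < (d²+e²)/2 < 1, then C_c(G) = 1. (Proposition 6.1) -/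
open MeasureTheory

noncomputable section

/-- The open upper half-plane `H = {(x,y) : y > 0}`. -/
def upperHalfPlane2 : Set (ℝ × ℝ) := {x | 0 < x.2}

/-- Nonzero smooth functions with compact support contained in `G`. -/
def IsTest (G : Set (ℝ × ℝ)) (v : ℝ × ℝ → ℝ) : Prop :=
  ContDiff ℝ (⊤ : ℕ∞) v ∧ HasCompactSupport v ∧ tsupport v ⊆ G ∧ ∃ x, v x ≠ 0

/-- Partial derivative in the x-direction. -/
def dX (f : ℝ × ℝ → ℝ) (x : ℝ × ℝ) : ℝ := fderiv ℝ f x (1, 0)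

/-- Partial derivative in the y-direction. -/
def dY (f : ℝ × ℝ → ℝ) (x : ℝ × ℝ) : ℝ := fderiv ℝ f x (0, 1)

/-- The weighted gradient norm `‖∇_c f‖_β` on `G`. -/
def gnorm (G : Set (ℝ × ℝ)) (c β : ℝ) (f : ℝ × ℝ → ℝ) : ℝ :=
  Real.sqrt (∫ x in G, (c ^ 2 * (dX f x) ^ 2 + (dY f x) ^ 2) * x.2 ^ (-β))

/-- The functional `F[v,ψ;G]` of (6.1). -/
def Fq (G : Set (ℝ × ℝ)) (α γ d e : ℝ) (v ψ : ℝ × ℝ → ℝ) : ℝ :=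
  (∫ x in G, (dX v x * dX ψ x + dY v x * dY ψ x) * x.2 ^ (-α)) /
    (gnorm G d (α + γ) v * gnorm G e (α - γ) ψ)

/-- The min-max constant `C_c(G; α, γ, d, e)` of (6.2). -/
def Cc (G : Set (ℝ × ℝ)) (α γ d e : ℝ) : ℝ :=
  ⨅ v : {v : ℝ × ℝ → ℝ // IsTest G v}, ⨆ ψ : {ψ : ℝ × ℝ → ℝ // IsTest G ψ},
    Fq G α γ d e v.1 ψ.1

lemma IsTest.continuous_dX {G : Set (ℝ × ℝ)} {v : ℝ × ℝ → ℝ} (hv : IsTest G v) :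
    Continuous (dX v) :=
  (hv.1.continuous_fderiv (by simp)).clm_apply continuous_const

lemma IsTest.continuous_dY {G : Set (ℝ × ℝ)} {v : ℝ × ℝ → ℝ} (hv : IsTest G v) :
    Continuous (dY v) :=
  (hv.1.continuous_fderiv (by simp)).clm_apply continuous_const

lemma dX_eq_zero_of_notMem_tsupport {v : ℝ × ℝ → ℝ} {x : ℝ × ℝ} (hx : x ∉ tsupport v) :
    dX v x = 0 := by
  have h : fderiv ℝ v x = 0 := by
    by_contra h
    exact hx (support_fderiv_subset ℝ h)
  simp [dX, h]

lemma dY_eq_zero_of_notMem_tsupport {v : ℝ × ℝ → ℝ} {x : ℝ × ℝ} (hx : x ∉ tsupport v) :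
    dY v x = 0 := by
  have h : fderiv ℝ v x = 0 := by
    by_contra h
    exact hx (support_fderiv_subset ℝ h)
  simp [dY, h]

lemma integrable_mul_snd_rpow {φ : ℝ × ℝ → ℝ} {K : Set (ℝ × ℝ)} (hφ : Continuous φ)
    (hK : IsCompact K) (hKs : K ⊆ upperHalfPlane2) (h0 : ∀ x ∉ K, φ x = 0) (β : ℝ) :
    Integrable (fun x : ℝ × ℝ => φ x * x.2 ^ β) := by
  have hcont : ContinuousOn (fun x : ℝ × ℝ => φ x * x.2 ^ β) K :=
    hφ.continuousOn.mul
      (continuous_snd.continuousOn.rpow_const fun x hx => Or.inl (hKs hx).ne')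
  refine (integrableOn_iff_integrable_of_support_subset ?_).1
    (hcont.integrableOn_compact hK)
  intro x hx
  by_contra hxK
  exact hx (by simp [h0 x hxK])

lemma exists_contDiff_bump {r : ℝ} (hr : 0 < r) : ∃ b : ℝ → ℝ, ContDiff ℝ (⊤ : ℕ∞) b ∧
    HasCompactSupport b ∧ b 0 = 1 ∧ ∀ t, r < |t| → b t = 0 := by
  let b : ContDiffBump (0 : ℝ) := ⟨r / 2, r, by positivity, by linarith⟩
  exact ⟨b, b.contDiff, b.hasCompactSupport, b.one_of_mem_closedBall (by simp [b.rIn_pos.le]),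
    fun t ht => b.zero_of_le_dist (by simpa [b] using ht.le)⟩

lemma hasFDerivAt_mul_dilate {f g : ℝ → ℝ} (hf : Differentiable ℝ f) (hg : Differentiable ℝ g)
    (k : ℝ) (p x : ℝ × ℝ) :
    HasFDerivAt (fun x : ℝ × ℝ => f (x.1 - p.1) * g (k * (x.2 - p.2)))
      (f (x.1 - p.1) • (deriv g (k * (x.2 - p.2)) • (k • ContinuousLinearMap.snd ℝ ℝ ℝ)) +
        g (k * (x.2 - p.2)) • (deriv f (x.1 - p.1) • ContinuousLinearMap.fst ℝ ℝ ℝ)) x := by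
  have h₁ : HasFDerivAt (fun x : ℝ × ℝ => x.1 - p.1) (ContinuousLinearMap.fst ℝ ℝ ℝ) x :=
    hasFDerivAt_fst.sub_const _
  have h₂ : HasFDerivAt (fun x : ℝ × ℝ => k * (x.2 - p.2))
      (k • ContinuousLinearMap.snd ℝ ℝ ℝ) x :=
    (hasFDerivAt_snd.sub_const _).const_mul _
  exact ((hf _).hasDerivAt.comp_hasFDerivAt x h₁).mul ((hg _).hasDerivAt.comp_hasFDerivAt x h₂)

lemma dX_mul_dilate {f g : ℝ → ℝ} (hf : Differentiable ℝ f) (hg : Differentiable ℝ g)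
    (k : ℝ) (p x : ℝ × ℝ) :
    dX (fun x : ℝ × ℝ => f (x.1 - p.1) * g (k * (x.2 - p.2))) x =
      deriv f (x.1 - p.1) * g (k * (x.2 - p.2)) := by
  simp [dX, (hasFDerivAt_mul_dilate hf hg k p x).fderiv, mul_comm]

lemma dY_mul_dilate {f g : ℝ → ℝ} (hf : Differentiable ℝ f) (hg : Differentiable ℝ g)
    (k : ℝ) (p x : ℝ × ℝ) :
    dY (fun x : ℝ × ℝ => f (x.1 - p.1) * g (k * (x.2 - p.2))) x =
      k * (f (x.1 - p.1) * deriv g (k * (x.2 - p.2))) := by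
  simp only [dY, (hasFDerivAt_mul_dilate hf hg k p x).fderiv, add_apply, smul_apply,
    ContinuousLinearMap.coe_fst', ContinuousLinearMap.coe_snd', smul_eq_mul]
  ring

lemma integral_mul_dilate (f g : ℝ → ℝ) {k : ℝ} (hk : 0 < k) (p : ℝ × ℝ) :
    ∫ x : ℝ × ℝ, f (x.1 - p.1) * g (k * (x.2 - p.2)) =
      (∫ t, f t) * (k⁻¹ * ∫ t, g t) := by
  rw [Measure.volume_eq_prod,
    integral_prod_mul (fun s => f (s - p.1)) (fun s => g (k * (s - p.2))),
    integral_sub_right_eq_self f p.1,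
    integral_sub_right_eq_self (fun s => g (k * s)) p.2, Measure.integral_comp_mul_left,
    abs_of_pos (inv_pos.2 hk), smul_eq_mul]

section

variable {G : Set (ℝ × ℝ)} {v ψ : ℝ × ℝ → ℝ}

lemma IsTest.integrable_dX_sq (hGs : G ⊆ upperHalfPlane2) (hv : IsTest G v) (β : ℝ) :
    Integrable (fun x : ℝ × ℝ => (dX v x) ^ 2 * x.2 ^ β) :=
  integrable_mul_snd_rpow (hv.continuous_dX.pow 2) hv.2.1 (hv.2.2.1.trans hGs)
    (fun x hx => by simp [dX_eq_zero_of_notMem_tsupport hx]) β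

lemma IsTest.integrable_dY_sq (hGs : G ⊆ upperHalfPlane2) (hv : IsTest G v) (β : ℝ) :
    Integrable (fun x : ℝ × ℝ => (dY v x) ^ 2 * x.2 ^ β) :=
  integrable_mul_snd_rpow (hv.continuous_dY.pow 2) hv.2.1 (hv.2.2.1.trans hGs)
    (fun x hx => by simp [dY_eq_zero_of_notMem_tsupport hx]) β

lemma IsTest.integrable_inner (hGs : G ⊆ upperHalfPlane2) (hv : IsTest G v)
    (hψ : IsTest G ψ) (β : ℝ) :
    Integrable (fun x : ℝ × ℝ => (dX v x * dX ψ x + dY v x * dY ψ x) * x.2 ^ β) :=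
  integrable_mul_snd_rpow
    ((hv.continuous_dX.mul hψ.continuous_dX).add (hv.continuous_dY.mul hψ.continuous_dY))
    hv.2.1 (hv.2.2.1.trans hGs)
    (fun x hx => by
      simp [dX_eq_zero_of_notMem_tsupport hx, dY_eq_zero_of_notMem_tsupport hx]) β

lemma IsTest.setIntegral_gradient (hGs : G ⊆ upperHalfPlane2) (hv : IsTest G v) (c β : ℝ) :
    ∫ x in G, (c ^ 2 * (dX v x) ^ 2 + (dY v x) ^ 2) * x.2 ^ β =
      c ^ 2 * (∫ x in G, (dX v x) ^ 2 * x.2 ^ β) + ∫ x in G, (dY v x) ^ 2 * x.2 ^ β := by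
  rw [← integral_const_mul, ← integral_add
    ((hv.integrable_dX_sq hGs β).integrableOn.const_mul _)
    (hv.integrable_dY_sq hGs β).integrableOn]
  congr 1 with x
  ring

lemma setIntegral_mul_snd_rpow_nonneg (hGo : IsOpen G) (hGs : G ⊆ upperHalfPlane2)
    {φ : ℝ × ℝ → ℝ} (hφ : ∀ x, 0 ≤ φ x) (β : ℝ) : 0 ≤ ∫ x in G, φ x * x.2 ^ β :=
  setIntegral_nonneg hGo.measurableSet fun x hx =>
    mul_nonneg (hφ x) (Real.rpow_nonneg (le_of_lt (hGs hx)) _)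

lemma gnorm_nonneg (c β : ℝ) (f : ℝ × ℝ → ℝ) : 0 ≤ gnorm G c β f := Real.sqrt_nonneg _

lemma IsTest.gnorm_mono (hGo : IsOpen G) (hGs : G ⊆ upperHalfPlane2) (hv : IsTest G v)
    {c₁ c₂ : ℝ} (hc₁ : 0 ≤ c₁) (hc : c₁ ≤ c₂) (β : ℝ) : gnorm G c₁ β v ≤ gnorm G c₂ β v := by
  unfold gnorm
  rw [hv.setIntegral_gradient hGs, hv.setIntegral_gradient hGs]
  have := setIntegral_mul_snd_rpow_nonneg hGo hGs (fun x => sq_nonneg (dX v x)) (-β)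
  gcongr

/-- The Cauchy–Schwarz inequality with the weight split between the two factors. -/
lemma IsTest.setIntegral_inner_le (hGo : IsOpen G) (hGs : G ⊆ upperHalfPlane2)
    (hv : IsTest G v) (hψ : IsTest G ψ) (α γ : ℝ) :
    ∫ x in G, (dX v x * dX ψ x + dY v x * dY ψ x) * x.2 ^ (-α) ≤
      gnorm G 1 (α + γ) v * gnorm G 1 (α - γ) ψ := by
  have hgrad : ∀ {f : ℝ × ℝ → ℝ}, IsTest G f → ∀ β : ℝ, IntegrableOn
      (fun x : ℝ × ℝ => ((1 : ℝ) ^ 2 * (dX f x) ^ 2 + (dY f x) ^ 2) * x.2 ^ β) G := by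
    intro f hf β
    refine ((hf.integrable_dX_sq hGs β).add (hf.integrable_dY_sq hGs β)).integrableOn.congr
      (Filter.Eventually.of_forall fun x => ?_)
    simp only [Pi.add_apply]
    ring
  have hquad : ∀ t : ℝ,
      0 ≤ (∫ x in G, ((1 : ℝ) ^ 2 * (dX v x) ^ 2 + (dY v x) ^ 2) * x.2 ^ (-(α + γ))) * (t * t) +
        (2 * ∫ x in G, (dX v x * dX ψ x + dY v x * dY ψ x) * x.2 ^ (-α)) * t +
        ∫ x in G, ((1 : ℝ) ^ 2 * (dX ψ x) ^ 2 + (dY ψ x) ^ 2) * x.2 ^ (-(α - γ)) := by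
    intro t
    have i₁ := (hgrad hv (-(α + γ))).mul_const (t * t)
    have i₂ := ((hv.integrable_inner hGs hψ (-α)).integrableOn (s := G)).const_mul 2 |>.mul_const t
    have i₃ := hgrad hψ (-(α - γ))
    rw [← integral_mul_const, ← integral_const_mul, ← integral_mul_const,
      ← integral_add i₁ i₂, ← integral_add (by exact i₁.add i₂) i₃]
    refine setIntegral_nonneg hGo.measurableSet fun x hx => ?_
    have hy : 0 < x.2 := hGs hx
    have e₁ : x.2 ^ (-(α + γ)) = (x.2 ^ (-(α + γ) / 2)) ^ 2 := by
      rw [← Real.rpow_natCast, ← Real.rpow_mul hy.le]; norm_num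
    have e₃ : x.2 ^ (-(α - γ)) = (x.2 ^ (-(α - γ) / 2)) ^ 2 := by
      rw [← Real.rpow_natCast, ← Real.rpow_mul hy.le]; norm_num
    have e₂ : x.2 ^ (-α) = x.2 ^ (-(α + γ) / 2) * x.2 ^ (-(α - γ) / 2) := by
      rw [← Real.rpow_add hy]; ring_nf
    rw [e₁, e₂, e₃]
    set s := x.2 ^ (-(α + γ) / 2)
    set r := x.2 ^ (-(α - γ) / 2)
    calc (0 : ℝ) ≤ (t * dX v x * s + dX ψ x * r) ^ 2 + (t * dY v x * s + dY ψ x * r) ^ 2 := by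
          positivity
      _ = _ := by ring
  have hdisc := discrim_le_zero hquad
  unfold gnorm
  rw [← Real.sqrt_mul (setIntegral_mul_snd_rpow_nonneg hGo hGs (fun _ => by positivity) _)]
  apply Real.le_sqrt_of_sq_le
  unfold discrim at hdisc
  linarith

lemma IsTest.Fq_le (hGo : IsOpen G) (hGs : G ⊆ upperHalfPlane2) (hv : IsTest G v)
    (hψ : IsTest G ψ) {α γ d e C : ℝ} (he : 1 ≤ e) (hC : 0 ≤ C)
    (h : gnorm G 1 (α + γ) v ≤ C * gnorm G d (α + γ) v) : Fq G α γ d e v ψ ≤ C := by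
  refine div_le_of_le_mul₀ (mul_nonneg (gnorm_nonneg _ _ _) (gnorm_nonneg _ _ _)) hC ?_
  calc _ ≤ _ := hv.setIntegral_inner_le hGo hGs hψ α γ
    _ ≤ (C * gnorm G d (α + γ) v) * gnorm G e (α - γ) ψ :=
        mul_le_mul h (hψ.gnorm_mono hGo hGs zero_le_one he _) (gnorm_nonneg _ _ _)
          (mul_nonneg hC (gnorm_nonneg _ _ _))
    _ = _ := by ring

lemma Fq_self_nonneg (hGo : IsOpen G) (hGs : G ⊆ upperHalfPlane2) (α γ d e : ℝ)
    (v : ℝ × ℝ → ℝ) : 0 ≤ Fq G α γ d e v v :=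
  div_nonneg (setIntegral_mul_snd_rpow_nonneg hGo hGs
    (fun _ => add_nonneg (mul_self_nonneg _) (mul_self_nonneg _)) _)
    (mul_nonneg (gnorm_nonneg _ _ _) (gnorm_nonneg _ _ _))

lemma iSup_Fq_nonneg (hGo : IsOpen G) (hGs : G ⊆ upperHalfPlane2) (α γ d e : ℝ)
    (v : {v : ℝ × ℝ → ℝ // IsTest G v}) :
    0 ≤ ⨆ ψ : {ψ : ℝ × ℝ → ℝ // IsTest G ψ}, Fq G α γ d e v.1 ψ.1 :=
  Real.iSup_nonneg' ⟨v, Fq_self_nonneg hGo hGs α γ d e v.1⟩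

lemma IsTest.gnorm_one_le_mul (hGo : IsOpen G) (hGs : G ⊆ upperHalfPlane2) (hv : IsTest G v)
    {β d ε : ℝ} (hε : 0 ≤ ε)
    (h : ∫ x in G, (dX v x) ^ 2 * x.2 ^ (-β) ≤ ε * ∫ x in G, (dY v x) ^ 2 * x.2 ^ (-β)) :
    gnorm G 1 β v ≤ (1 + ε) * gnorm G d β v := by
  have hX := setIntegral_mul_snd_rpow_nonneg hGo hGs (fun x => sq_nonneg (dX v x)) (-β)
  have hY := setIntegral_mul_snd_rpow_nonneg hGo hGs (fun x => sq_nonneg (dY v x)) (-β)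
  unfold gnorm
  rw [hv.setIntegral_gradient hGs, hv.setIntegral_gradient hGs]
  set X := ∫ x in G, (dX v x) ^ 2 * x.2 ^ (-β)
  set Y := ∫ x in G, (dY v x) ^ 2 * x.2 ^ (-β)
  rw [← Real.sqrt_sq (by positivity : 0 ≤ 1 + ε), ← Real.sqrt_mul (by positivity)]
  refine Real.sqrt_le_sqrt ?_
  have h₁ : 0 ≤ (1 + ε) ^ 2 * (d ^ 2 * X) := by positivity
  nlinarith [mul_nonneg hε hY, mul_nonneg (mul_nonneg hε hε) hY]

/-- Dilating a bump function in the vertical direction makes its horizontal energy negligible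
relative to its vertical energy. -/
lemma exists_isTest_setIntegral_dX_le (hGne : G.Nonempty) (hGo : IsOpen G)
    (hGs : G ⊆ upperHalfPlane2) (β : ℝ) {ε : ℝ} (hε : 0 < ε) :
    ∃ v, IsTest G v ∧
      ∫ x in G, (dX v x) ^ 2 * x.2 ^ β ≤ ε * ∫ x in G, (dY v x) ^ 2 * x.2 ^ β := by
  obtain ⟨p, hp⟩ := hGne
  obtain ⟨r, hr, hrG⟩ := Metric.nhds_basis_closedBall.mem_iff.1 (hGo.mem_nhds hp)
  obtain ⟨b, hb, hbs, hb0, hbout⟩ := exists_contDiff_bump hr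
  have hbd : Differentiable ℝ b := hb.differentiable (by simp)
  have hb' : Continuous (deriv b) := hb.continuous_deriv (by simp)
  have hbs' : HasCompactSupport (deriv b) := hbs.deriv
  have hI₀ : 0 < ∫ t, b t ^ 2 :=
    (hb.continuous.pow 2).integral_pos_of_hasCompactSupport_nonneg_nonzero
      (hbs.comp_left (g := fun s : ℝ => s ^ 2) (by simp)) (fun t => sq_nonneg _)
      (x := 0) (by simp [hb0])
  have hI₁ : 0 < ∫ t, deriv b t ^ 2 := by
    obtain ⟨t, ht⟩ : ∃ t, deriv b t ≠ 0 := by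
      by_contra! h
      have := is_const_of_deriv_eq_zero hbd h 0 (r + 1)
      rw [hb0, hbout (r + 1) (by rw [abs_of_pos (by linarith)]; linarith)] at this
      exact one_ne_zero this
    exact (hb'.pow 2).integral_pos_of_hasCompactSupport_nonneg_nonzero
      (hbs'.comp_left (g := fun s : ℝ => s ^ 2) (by simp)) (fun t => sq_nonneg _)
      (x := t) (by simpa using ht)
  set I₀ := ∫ t, b t ^ 2
  set I₁ := ∫ t, deriv b t ^ 2
  have hBc : IsCompact (Metric.closedBall p r) := isCompact_closedBall p r
  have hwc : ContinuousOn (fun x : ℝ × ℝ => x.2 ^ β) (Metric.closedBall p r) :=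
    continuous_snd.continuousOn.rpow_const fun x hx => Or.inl (hGs (hrG hx)).ne'
  have hBne : (Metric.closedBall p r).Nonempty := ⟨p, Metric.mem_closedBall_self hr.le⟩
  obtain ⟨q₁, hq₁, hmin⟩ := hBc.exists_isMinOn hBne hwc
  obtain ⟨q₂, -, hmax⟩ := hBc.exists_isMaxOn hBne hwc
  have hm : 0 < q₁.2 ^ β := Real.rpow_pos_of_pos (hGs (hrG hq₁)) _
  set m := q₁.2 ^ β
  set M := q₂.2 ^ β
  obtain ⟨k, hk⟩ := exists_nat_ge (max 1 (M / (ε * m)))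
  have hk1 : (1 : ℝ) ≤ k := (le_max_left _ _).trans hk
  have hkM : M ≤ ε * (m * (k : ℝ) ^ 2) := by
    have h₁ : M / (ε * m) ≤ k := (le_max_right _ _).trans hk
    rw [div_le_iff₀ (by positivity)] at h₁
    have : ε * m * k ≤ ε * m * k ^ 2 := by gcongr; nlinarith
    linarith
  have hk0 : (0 : ℝ) < k := by linarith
  let v : ℝ × ℝ → ℝ := fun x => b (x.1 - p.1) * b (k * (x.2 - p.2))
  have hv : ContDiff ℝ (⊤ : ℕ∞) v :=
    (hb.comp (contDiff_fst.sub contDiff_const)).mul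
      (hb.comp (contDiff_const.mul (contDiff_snd.sub contDiff_const)))
  have hvs : tsupport v ⊆ Metric.closedBall p r := by
    refine closure_minimal (fun x hx => ?_) Metric.isClosed_closedBall
    by_contra hxB
    apply hx
    rw [Metric.mem_closedBall, Prod.dist_eq, sup_le_iff, not_and_or, not_le, not_le,
      Real.dist_eq, Real.dist_eq] at hxB
    rcases hxB with h | h
    · simp [v, hbout _ h]
    · have : r < |k * (x.2 - p.2)| := by
        rw [abs_mul, abs_of_pos hk0]; nlinarith [abs_nonneg (x.2 - p.2)]
      simp [v, hbout _ this]
  have hvt : IsTest G v :=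
    ⟨hv, HasCompactSupport.of_support_subset_isCompact hBc (subset_closure.trans hvs),
      hvs.trans hrG, p, by simp [v, hb0]⟩
  have hdX : ∀ x, dX v x = deriv b (x.1 - p.1) * b (k * (x.2 - p.2)) :=
    dX_mul_dilate hbd hbd k p
  have hdY : ∀ x, dY v x = k * (b (x.1 - p.1) * deriv b (k * (x.2 - p.2))) :=
    dY_mul_dilate hbd hbd k p
  have hintX : ∫ x, dX v x ^ 2 = I₁ * ((k : ℝ)⁻¹ * I₀) := by
    simp only [hdX, mul_pow]
    exact integral_mul_dilate (fun t => deriv b t ^ 2) (fun t => b t ^ 2) hk0 p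
  have hintY : ∫ x, dY v x ^ 2 = (k : ℝ) ^ 2 * (I₀ * ((k : ℝ)⁻¹ * I₁)) := by
    simp only [hdY, mul_pow]
    rw [integral_const_mul]
    congr 1
    exact integral_mul_dilate (fun t => b t ^ 2) (fun t => deriv b t ^ 2) hk0 p
  have hset : ∀ {f : ℝ × ℝ → ℝ}, (∀ x ∉ tsupport v, f x = 0) →
      ∫ x in G, f x * x.2 ^ β = ∫ x, f x * x.2 ^ β := fun hf =>
    setIntegral_eq_integral_of_forall_compl_eq_zero fun x hx => by
      simp [hf x fun h => hx (hrG (hvs h))]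
  have hX0 : ∀ x ∉ tsupport v, dX v x ^ 2 = 0 := fun x hx => by
    simp [dX_eq_zero_of_notMem_tsupport hx]
  have hY0 : ∀ x ∉ tsupport v, dY v x ^ 2 = 0 := fun x hx => by
    simp [dY_eq_zero_of_notMem_tsupport hx]
  have hXi : Integrable fun x => dX v x ^ 2 := by
    simpa using hvt.integrable_dX_sq hGs 0
  have hYi : Integrable fun x => dY v x ^ 2 := by
    simpa using hvt.integrable_dY_sq hGs 0
  refine ⟨v, hvt, ?_⟩
  rw [hset hX0, hset hY0]
  calc ∫ x, dX v x ^ 2 * x.2 ^ β ≤ ∫ x, M * dX v x ^ 2 := by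
        refine integral_mono (hvt.integrable_dX_sq hGs β) (hXi.const_mul M) fun x => ?_
        by_cases hx : x ∈ tsupport v
        · have : x.2 ^ β ≤ M := hmax (hvs hx)
          nlinarith [sq_nonneg (dX v x)]
        · simp [hX0 x hx]
    _ = M * (I₁ * ((k : ℝ)⁻¹ * I₀)) := by rw [integral_const_mul, hintX]
    _ ≤ ε * (m * (k : ℝ) ^ 2) * (I₁ * ((k : ℝ)⁻¹ * I₀)) := by gcongr
    _ = ε * ∫ x, m * dY v x ^ 2 := by rw [integral_const_mul, hintY]; ring
    _ ≤ ε * ∫ x, dY v x ^ 2 * x.2 ^ β := by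
        refine mul_le_mul_of_nonneg_left ?_ hε.le
        refine integral_mono (hYi.const_mul m) (hvt.integrable_dY_sq hGs β) fun x => ?_
        by_cases hx : x ∈ tsupport v
        · have : m ≤ x.2 ^ β := hmin (hvs hx)
          nlinarith [sq_nonneg (dY v x)]
        · simp [hY0 x hx]

lemma Cc_nonneg (hGo : IsOpen G) (hGs : G ⊆ upperHalfPlane2) (α γ d e : ℝ) :
    0 ≤ Cc G α γ d e :=
  Real.iInf_nonneg (iSup_Fq_nonneg hGo hGs α γ d e)

lemma Cc_le_one (hGne : G.Nonempty) (hGo : IsOpen G) (hGs : G ⊆ upperHalfPlane2)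
    (α γ d : ℝ) {e : ℝ} (he : 1 ≤ e) : Cc G α γ d e ≤ 1 := by
  refine le_of_forall_pos_le_add fun ε hε => ?_
  obtain ⟨v, hv, hle⟩ := exists_isTest_setIntegral_dX_le hGne hGo hGs (-(α + γ)) hε
  refine (ciInf_le ⟨0, ?_⟩ (⟨v, hv⟩ : {v : ℝ × ℝ → ℝ // IsTest G v})).trans ?_
  · rintro _ ⟨w, rfl⟩
    exact iSup_Fq_nonneg hGo hGs α γ d e w
  · exact Real.iSup_le (fun ψ => hv.Fq_le hGo hGs ψ.2 he (by positivity)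
      (hv.gnorm_one_le_mul hGo hGs hε.le hle)) (by positivity)

lemma IsTest.exists_fderiv_ne_zero (hv : IsTest G v) : ∃ x, fderiv ℝ v x ≠ 0 := by
  by_contra! h
  obtain ⟨x, hx⟩ := hv.2.2.2
  obtain ⟨y, hy⟩ := (Set.ne_univ_iff_exists_notMem _).1 hv.2.1.isCompact.ne_univ
  exact hx ((is_const_of_fderiv_eq_zero (hv.1.differentiable (by simp)) h x y).trans
    (image_eq_zero_of_notMem_tsupport hy))

lemma IsTest.gnorm_pos (hGo : IsOpen G) (hGs : G ⊆ upperHalfPlane2) (hv : IsTest G v)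
    {c : ℝ} (hc : 0 < c) (β : ℝ) : 0 < gnorm G c β v := by
  have hcX : Continuous fun x => c ^ 2 * (dX v x) ^ 2 + (dY v x) ^ 2 :=
    (continuous_const.mul (hv.continuous_dX.pow 2)).add (hv.continuous_dY.pow 2)
  have hint := integrable_mul_snd_rpow hcX hv.2.1 (hv.2.2.1.trans hGs)
    (fun x hx => by
      simp [dX_eq_zero_of_notMem_tsupport hx, dY_eq_zero_of_notMem_tsupport hx]) (-β)
  obtain ⟨x, hx⟩ := hv.exists_fderiv_ne_zero
  have hxG : x ∈ G := hv.2.2.1 (support_fderiv_subset ℝ hx)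
  have hxpos : 0 < c ^ 2 * (dX v x) ^ 2 + (dY v x) ^ 2 := by
    by_contra! h
    have hX : dX v x = 0 := by
      have : (c * dX v x) ^ 2 ≤ 0 := by nlinarith [sq_nonneg (dY v x)]
      simpa [hc.ne'] using sq_nonpos_iff _ |>.1 this
    have hY : dY v x = 0 := by
      refine sq_nonpos_iff _ |>.1 ?_
      nlinarith [sq_nonneg (c * dX v x)]
    refine hx (ContinuousLinearMap.ext fun z => ?_)
    have hz : z = z.1 • ((1, 0) : ℝ × ℝ) + z.2 • ((0, 1) : ℝ × ℝ) := by ext <;> simp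
    rw [hz, map_add, map_smul, map_smul]
    simp only [dX, dY] at hX hY
    simp [hX, hY]
  refine Real.sqrt_pos.2 ((setIntegral_pos_iff_support_of_nonneg_ae ?_ hint.integrableOn).2 ?_)
  · refine (ae_restrict_iff' hGo.measurableSet).2 (Filter.Eventually.of_forall fun y hy => ?_)
    exact mul_nonneg (by positivity) (Real.rpow_nonneg (le_of_lt (hGs hy)) _)
  · refine ((((isOpen_lt continuous_const hcX).inter hGo).measure_pos volume
      ⟨x, hxpos, hxG⟩)).trans_le (measure_mono ?_)
    rintro y ⟨hy, hyG⟩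
    exact ⟨(mul_pos hy (Real.rpow_pos_of_pos (hGs hyG) _)).ne', hyG⟩

lemma IsTest.one_le_Fq_self (hGo : IsOpen G) (hGs : G ⊆ upperHalfPlane2) (hv : IsTest G v)
    {d e : ℝ} (hd : 0 < d) (he : 0 < e) (h₁ : e ^ 2 * d ^ 2 ≤ 1) (h₂ : d ^ 2 + e ^ 2 ≤ 2)
    (α : ℝ) : 1 ≤ Fq G α 0 d e v v := by
  have hd' := hv.gnorm_pos hGo hGs hd (α + 0)
  have he' := hv.gnorm_pos hGo hGs he (α - 0)
  rw [Fq, one_le_div (mul_pos hd' he')]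
  have hX := setIntegral_mul_snd_rpow_nonneg hGo hGs (fun x => sq_nonneg (dX v x)) (-α)
  have hY := setIntegral_mul_snd_rpow_nonneg hGo hGs (fun x => sq_nonneg (dY v x)) (-α)
  have hn : ∫ x in G, (dX v x * dX v x + dY v x * dY v x) * x.2 ^ (-α) =
      (∫ x in G, (dX v x) ^ 2 * x.2 ^ (-α)) + ∫ x in G, (dY v x) ^ 2 * x.2 ^ (-α) := by
    simpa [sq] using hv.setIntegral_gradient hGs 1 (-α)
  unfold gnorm
  rw [hn, add_zero, sub_zero, hv.setIntegral_gradient hGs, hv.setIntegral_gradient hGs]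
  set X := ∫ x in G, (dX v x) ^ 2 * x.2 ^ (-α)
  set Y := ∫ x in G, (dY v x) ^ 2 * x.2 ^ (-α)
  rw [← Real.sqrt_mul (by positivity)]
  refine Real.sqrt_le_iff.2 ⟨by positivity, ?_⟩
  nlinarith [mul_nonneg (mul_nonneg hX hX) (sub_nonneg.2 h₁),
    mul_nonneg (mul_nonneg hX hY) (sub_nonneg.2 h₂)]

lemma IsTest.bddAbove_Fq (hGo : IsOpen G) (hGs : G ⊆ upperHalfPlane2) (hv : IsTest G v)
    {d e : ℝ} (hd : 0 < d) (he : 1 ≤ e) (α γ : ℝ) :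
    BddAbove (Set.range fun ψ : {ψ : ℝ × ℝ → ℝ // IsTest G ψ} => Fq G α γ d e v ψ.1) := by
  refine ⟨gnorm G 1 (α + γ) v / gnorm G d (α + γ) v, ?_⟩
  rintro _ ⟨ψ, rfl⟩
  refine hv.Fq_le hGo hGs ψ.2 he (div_nonneg (gnorm_nonneg _ _ _) (gnorm_nonneg _ _ _)) ?_
  rw [div_mul_cancel₀ _ (hv.gnorm_pos hGo hGs hd _).ne']

lemma one_le_Cc (hGne : G.Nonempty) (hGo : IsOpen G) (hGs : G ⊆ upperHalfPlane2)
    (α : ℝ) {d e : ℝ} (hd : 0 < d) (he : 1 ≤ e) (h₁ : e ^ 2 * d ^ 2 ≤ 1)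
    (h₂ : d ^ 2 + e ^ 2 ≤ 2) : 1 ≤ Cc G α 0 d e := by
  obtain ⟨w, hw, -⟩ := exists_isTest_setIntegral_dX_le hGne hGo hGs 0 one_pos
  have : Nonempty {v : ℝ × ℝ → ℝ // IsTest G v} := ⟨⟨w, hw⟩⟩
  exact le_ciInf fun v => (v.2.one_le_Fq_self hGo hGs hd (by linarith) h₁ h₂ α).trans
    (le_ciSup (v.2.bddAbove_Fq hGo hGs hd he α 0) v)

end

/-- Proposition 6.1: for a nonempty open `G ⊆ H` and parameters `α ≥ 0 ≤ γ`, γ ≥ α,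
`0 < d ≤ 1 ≤ e`, one has `0 ≤ C_c(G) ≤ 1`; and if `γ = 0` (any `α ≥ 0`) and
`e²d² < (d²+e²)/2 < 1`, then `C_c(G) = 1`. -/
theorem prop_6_1 (G : Set (ℝ × ℝ)) (hGne : G.Nonempty) (hGo : IsOpen G)
    (hGs : G ⊆ upperHalfPlane2)
    (α d e : ℝ) (hα : 0 ≤ α) (hd0 : 0 < d) (hd1 : d ≤ 1) (he : 1 ≤ e) :
    (∀ γ : ℝ, α ≤ γ → 0 ≤ Cc G α γ d e ∧ Cc G α γ d e ≤ 1) ∧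
    (e ^ 2 * d ^ 2 < (d ^ 2 + e ^ 2) / 2 → (d ^ 2 + e ^ 2) / 2 < 1 →
      Cc G α 0 d e = 1) := by
  refine ⟨fun γ _ => ⟨Cc_nonneg hGo hGs α γ d e, Cc_le_one hGne hGo hGs α γ d he⟩,
    fun h₁ h₂ => le_antisymm (Cc_le_one hGne hGo hGs α 0 d he) ?_⟩
  exact one_le_Cc hGne hGo hGs α hd0 he (by linarith) (by linarith)
end
end

section
/- Let 0 < B < 1 and 0 < γ̃ < 1. For nonzero continuously differentiable functions v, ψ : [B,1] → ℝ with v(B) = v(1) = ψ(B) = ψ(1) = 0, define F̃₀[v,ψ] := (∫_B^1 v'(z) ψ'(z) dz) / ((∫_B^1 v'(z)² z^{-γ̃} dz)^{1/2} · (∫_B^1 ψ'(z)² z^{γ̃} dz)^{1/2}). Then the infimum over such nonzero v of the supremum over such nonzero ψ of F̃₀[v,ψ] equals μ₀, where μ₀ > 0 and μ₀² = (1−B)²·(1−γ̃)(1+γ̃) / ((1 − B^{1−γ̃})(1 − B^{1+γ̃})). (Appendix D: exact value of the one-dimensional, x-independent min-max problem, eq. (6.2.4)) -/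
open MeasureTheory

noncomputable section

/-- Admissible pairs `(v, v')`: `v` is continuously differentiable on `[B,1]` with
derivative `v'`, vanishes at both endpoints, and is not identically zero. -/
def Adm (B : ℝ) (p : (ℝ → ℝ) × (ℝ → ℝ)) : Prop :=
  (∀ z ∈ Set.Icc B 1, HasDerivAt p.1 (p.2 z) z) ∧
  ContinuousOn p.2 (Set.Icc B 1) ∧ p.1 B = 0 ∧ p.1 1 = 0 ∧
  ∃ z ∈ Set.Icc B 1, p.1 z ≠ 0

/-- The one-dimensional, x-independent functional `F̃₀[v,ψ]` of (D.3). -/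
def F0 (B t : ℝ) (v ψ : (ℝ → ℝ) × (ℝ → ℝ)) : ℝ :=
  (∫ z in Set.Ioo B 1, v.2 z * ψ.2 z) /
    (Real.sqrt (∫ z in Set.Ioo B 1, (v.2 z) ^ 2 * z ^ (-t)) *
     Real.sqrt (∫ z in Set.Ioo B 1, (ψ.2 z) ^ 2 * z ^ t))

/-- The functional `F0` in terms of interval integrals. -/
lemma F0_eq_intervalIntegral {B : ℝ} (hB1 : B < 1) (t : ℝ) (v ψ : (ℝ → ℝ) × (ℝ → ℝ)) :
    F0 B t v ψ = (∫ z in B..1, v.2 z * ψ.2 z) /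
      (Real.sqrt (∫ z in B..1, (v.2 z) ^ 2 * z ^ (-t)) *
        Real.sqrt (∫ z in B..1, (ψ.2 z) ^ 2 * z ^ t)) := by
  simp only [F0, intervalIntegral.integral_of_le hB1.le, integral_Ioc_eq_integral_Ioo]

lemma integral_sq_add_mul {a b : ℝ} (hab : a ≤ b) {f g w : ℝ → ℝ}
    (hf : ContinuousOn f (Set.Icc a b)) (hg : ContinuousOn g (Set.Icc a b))
    (hw : ContinuousOn w (Set.Icc a b)) (α β : ℝ) :
    ∫ z in a..b, (α * f z + β * g z) ^ 2 * w z =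
      α ^ 2 * (∫ z in a..b, f z ^ 2 * w z) + 2 * α * β * (∫ z in a..b, f z * g z * w z) +
        β ^ 2 * ∫ z in a..b, g z ^ 2 * w z := by
  have h1 : IntervalIntegrable (fun z => f z ^ 2 * w z) volume a b :=
    ContinuousOn.intervalIntegrable_of_Icc hab (by fun_prop)
  have h2 : IntervalIntegrable (fun z => f z * g z * w z) volume a b :=
    ContinuousOn.intervalIntegrable_of_Icc hab (by fun_prop)
  have h3 : IntervalIntegrable (fun z => g z ^ 2 * w z) volume a b :=
    ContinuousOn.intervalIntegrable_of_Icc hab (by fun_prop)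
  rw [← intervalIntegral.integral_const_mul, ← intervalIntegral.integral_const_mul,
    ← intervalIntegral.integral_const_mul,
    ← intervalIntegral.integral_add (h1.const_mul _) (h2.const_mul _),
    ← intervalIntegral.integral_add ((h1.const_mul _).add (h2.const_mul _)) (h3.const_mul _)]
  congr 1
  ext z
  ring

/-- Weighted Cauchy–Schwarz inequality for continuous functions on a compact interval. -/
lemma sq_integral_mul_mul_le {a b : ℝ} (hab : a ≤ b) {f g w : ℝ → ℝ}
    (hf : ContinuousOn f (Set.Icc a b)) (hg : ContinuousOn g (Set.Icc a b))
    (hw : ContinuousOn w (Set.Icc a b)) (hw0 : ∀ z ∈ Set.Icc a b, 0 ≤ w z) :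
    (∫ z in a..b, f z * g z * w z) ^ 2 ≤
      (∫ z in a..b, f z ^ 2 * w z) * ∫ z in a..b, g z ^ 2 * w z := by
  have key := discrim_le_zero (a := ∫ z in a..b, f z ^ 2 * w z)
    (b := 2 * ∫ z in a..b, f z * g z * w z) (c := ∫ z in a..b, g z ^ 2 * w z) (fun x => by
      have h := integral_sq_add_mul hab hf hg hw x 1
      have h0 : 0 ≤ ∫ z in a..b, (x * f z + 1 * g z) ^ 2 * w z :=
        intervalIntegral.integral_nonneg hab fun z hz => mul_nonneg (sq_nonneg _) (hw0 z hz)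
      linarith)
  unfold discrim at key
  linarith

lemma continuousOn_rpow_Icc {B : ℝ} (hB0 : 0 < B) (s : ℝ) :
    ContinuousOn (fun z : ℝ => z ^ s) (Set.Icc B 1) :=
  continuousOn_id.rpow_const fun _ hz => Or.inl (hB0.trans_le hz.1).ne'

lemma rpow_mul_rpow_neg_cancel {z : ℝ} (hz : 0 < z) (s : ℝ) : z ^ s * z ^ (-s) = 1 := by
  rw [← Real.rpow_add hz, add_neg_cancel, Real.rpow_zero]

lemma intervalIntegral_congr_Icc {B : ℝ} (hB1 : B < 1) {f g : ℝ → ℝ}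
    (h : ∀ z ∈ Set.Icc B 1, f z = g z) : ∫ z in B..1, f z = ∫ z in B..1, g z :=
  intervalIntegral.integral_congr fun z hz => h z (by rwa [Set.uIcc_of_le hB1.le] at hz)

lemma sq_integral_mul_le_rpow {B : ℝ} (hB0 : 0 < B) (hB1 : B < 1) (s : ℝ) {f g : ℝ → ℝ}
    (hf : ContinuousOn f (Set.Icc B 1)) (hg : ContinuousOn g (Set.Icc B 1)) :
    (∫ z in B..1, f z * g z) ^ 2 ≤
      (∫ z in B..1, f z ^ 2 * z ^ (-s)) * ∫ z in B..1, g z ^ 2 * z ^ s := by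
  have h := sq_integral_mul_mul_le hB1.le (hf.mul (continuousOn_rpow_Icc hB0 (-s))) hg
    (continuousOn_rpow_Icc hB0 s) fun z hz => Real.rpow_nonneg (hB0.le.trans hz.1) s
  convert h using 2
  · refine intervalIntegral_congr_Icc hB1 fun z hz => ?_
    have := rpow_mul_rpow_neg_cancel (hB0.trans_le hz.1) s
    simp only [Pi.mul_apply]
    linear_combination (-(f z * g z)) * this
  · refine intervalIntegral_congr_Icc hB1 fun z hz => ?_
    have := rpow_mul_rpow_neg_cancel (hB0.trans_le hz.1) s
    simp only [Pi.mul_apply]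
    linear_combination (-(f z ^ 2 * z ^ (-s))) * this

lemma integral_sq_rpow_add_const {B : ℝ} (hB0 : 0 < B) (hB1 : B < 1) (s α β : ℝ) :
    ∫ z in B..1, (α * z ^ s + β) ^ 2 * z ^ (-s) =
      α ^ 2 * (∫ z in B..1, z ^ s) + 2 * α * β * (1 - B) + β ^ 2 * ∫ z in B..1, z ^ (-s) := by
  have h := integral_sq_add_mul hB1.le (continuousOn_rpow_Icc hB0 s)
    (continuousOn_const (c := (1 : ℝ))) (continuousOn_rpow_Icc hB0 (-s)) α β
  have e1 : ∫ z in B..1, (z ^ s) ^ 2 * z ^ (-s) = ∫ z in B..1, z ^ s :=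
    intervalIntegral_congr_Icc hB1 fun z hz => by
      have := rpow_mul_rpow_neg_cancel (hB0.trans_le hz.1) s
      linear_combination z ^ s * this
  have e2 : ∫ z in B..1, z ^ s * 1 * z ^ (-s) = 1 - B := by
    rw [intervalIntegral_congr_Icc hB1 (g := fun _ => (1 : ℝ)) fun z hz => by
      rw [mul_one, rpow_mul_rpow_neg_cancel (hB0.trans_le hz.1) s]]
    simp
  rw [e1, e2] at h
  simpa only [mul_one, one_pow, one_mul] using h

lemma integral_rpow_pos {B : ℝ} (hB0 : 0 < B) (hB1 : B < 1) (s : ℝ) :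
    0 < ∫ z in B..1, z ^ s :=
  intervalIntegral.integral_pos hB1 (continuousOn_rpow_Icc hB0 s)
    (fun z hz => Real.rpow_nonneg (hB0.trans hz.1).le s)
    ⟨1, ⟨hB1.le, le_rfl⟩, by simp⟩

lemma Adm.integral_eq_zero {B : ℝ} (hB1 : B < 1) {p : (ℝ → ℝ) × (ℝ → ℝ)} (hp : Adm B p) :
    ∫ z in B..1, p.2 z = 0 := by
  obtain ⟨hd, hc, h0, h1, -⟩ := hp
  rw [intervalIntegral.integral_eq_sub_of_hasDerivAt (f := p.1)
    (fun z hz => hd z (by rwa [Set.uIcc_of_le hB1.le] at hz))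
    (hc.intervalIntegrable_of_Icc hB1.le), h0, h1, sub_zero]

lemma Adm.exists_deriv_ne_zero {B : ℝ} {p : (ℝ → ℝ) × (ℝ → ℝ)} (hp : Adm B p) :
    ∃ z ∈ Set.Icc B 1, p.2 z ≠ 0 := by
  obtain ⟨hd, hc, h0, h1, z, hz, hne⟩ := hp
  by_contra! h
  refine hne ?_
  rw [← h0]
  refine constant_of_has_deriv_right_zero (fun x hx => (hd x hx).continuousAt.continuousWithinAt)
    (fun x hx => ?_) z hz
  have hx' := Set.Ico_subset_Icc_self hx
  simpa only [h x hx'] using (hd x hx').hasDerivWithinAt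

/-- A nonzero continuous function of mean zero on `[B,1]` is the derivative of an admissible
function. -/
lemma exists_adm_of_integral_eq_zero {B : ℝ} (hB1 : B < 1) {g : ℝ → ℝ}
    (hg : ContinuousOn g (Set.Icc B 1)) (hint : ∫ z in B..1, g z = 0)
    (hne : ∃ z ∈ Set.Icc B 1, g z ≠ 0) :
    ∃ p, Adm B p ∧ ∀ z ∈ Set.Icc B 1, p.2 z = g z := by
  set G : ℝ → ℝ := Set.IccExtend hB1.le ((Set.Icc B 1).domRestrict g) with hG
  have hGc : Continuous G := hg.domRestrict.Icc_extend'
  have hGg : ∀ z ∈ Set.Icc B 1, G z = g z := fun z hz => by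
    rw [hG, Set.IccExtend_of_mem _ _ hz, Set.domRestrict_apply]
  have hd : ∀ z, HasDerivAt (fun x => ∫ y in B..x, G y) (G z) z := fun z =>
    hGc.integral_hasStrictDerivAt B z |>.hasDerivAt
  refine ⟨(fun x => ∫ y in B..x, G y, G), ⟨fun z _ => hd z, hGc.continuousOn, by simp, ?_, ?_⟩,
    hGg⟩
  · exact (intervalIntegral_congr_Icc hB1 hGg).trans hint
  · by_contra! h
    obtain ⟨z, hz, hgz⟩ := hne
    refine hgz ?_
    have h0 : HasDerivWithinAt (fun x => ∫ y in B..x, G y) 0 (Set.Icc B 1) z :=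
      (hasDerivWithinAt_const z (Set.Icc B 1) (0 : ℝ)).congr h (h z hz)
    rw [← hGg z hz]
    exact (uniqueDiffOn_Icc hB1 z hz).eq_deriv _ (hd z).hasDerivWithinAt h0

lemma F0_le_one {B : ℝ} (hB0 : 0 < B) (hB1 : B < 1) (t : ℝ) {v ψ : (ℝ → ℝ) × (ℝ → ℝ)}
    (hv : Adm B v) (hψ : Adm B ψ) : F0 B t v ψ ≤ 1 := by
  rw [F0_eq_intervalIntegral hB1]
  refine div_le_of_le_mul₀ (by positivity) zero_le_one ?_
  rw [one_mul, ← Real.sqrt_mul]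
  · exact Real.le_sqrt_of_sq_le (sq_integral_mul_le_rpow hB0 hB1 t hv.2.1 hψ.2.1)
  · exact intervalIntegral.integral_nonneg hB1.le fun z hz =>
      mul_nonneg (sq_nonneg _) (Real.rpow_nonneg (hB0.le.trans hz.1) _)

/-- For every admissible `v` some admissible `ψ` makes `F0` at least the min-max value. -/
lemma exists_le_F0 {B : ℝ} (hB0 : 0 < B) (hB1 : B < 1) (t : ℝ) {v : (ℝ → ℝ) × (ℝ → ℝ)}
    (hv : Adm B v) : ∃ ψ, Adm B ψ ∧
      (1 - B) / Real.sqrt ((∫ z in B..1, z ^ t) * ∫ z in B..1, z ^ (-t)) ≤ F0 B t v ψ := by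
  have hP := integral_rpow_pos hB0 hB1 t
  have hW := integral_rpow_pos hB0 hB1 (-t)
  have hc := hv.2.1
  have hw := continuousOn_rpow_Icc hB0 (-t)
  have hcw : IntervalIntegrable (fun z => v.2 z * z ^ (-t)) volume B 1 :=
    (hc.mul hw).intervalIntegrable_of_Icc hB1.le
  have hE : ∀ c, ∫ z in B..1, (v.2 z - c) ^ 2 * z ^ (-t) =
      (∫ z in B..1, v.2 z ^ 2 * z ^ (-t)) - 2 * c * (∫ z in B..1, v.2 z * z ^ (-t)) +
        c ^ 2 * ∫ z in B..1, z ^ (-t) := fun c => by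
    have h := integral_sq_add_mul hB1.le hc (continuousOn_const (c := (1 : ℝ))) hw 1 (-c)
    simp only [one_mul, mul_one, one_pow, ← sub_eq_add_neg] at h
    rw [h]
    ring
  have hlin : ∀ c, ∫ z in B..1, (v.2 z - c) * z ^ (-t) =
      (∫ z in B..1, v.2 z * z ^ (-t)) - c * ∫ z in B..1, z ^ (-t) := fun c => by
    rw [← intervalIntegral.integral_const_mul, ← intervalIntegral.integral_sub hcw
      ((hw.intervalIntegrable_of_Icc hB1.le).const_mul _)]
    simp only [sub_mul]
  have hk : ∀ k, ∫ z in B..1, v.2 z * (z ^ (-t) - k) = ∫ z in B..1, v.2 z * z ^ (-t) :=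
    fun k => by
    simp only [mul_sub]
    rw [intervalIntegral.integral_sub hcw
      ((hc.intervalIntegrable_of_Icc hB1.le).mul_const _), intervalIntegral.integral_mul_const,
      hv.integral_eq_zero hB1, zero_mul, sub_zero]
  have hA : 0 < ∫ z in B..1, v.2 z ^ 2 * z ^ (-t) := by
    obtain ⟨z, hz, hne⟩ := hv.exists_deriv_ne_zero
    refine intervalIntegral.integral_pos hB1 ((hc.pow 2).mul hw)
      (fun x hx => mul_nonneg (sq_nonneg _) (Real.rpow_nonneg (hB0.trans hx.1).le _))
      ⟨z, hz, mul_pos (by positivity) (Real.rpow_pos_of_pos (hB0.trans_le hz.1) _)⟩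
  have hM := fun k => sq_integral_mul_le_rpow hB0 hB1 t hc (hw.sub (continuousOn_const (c := k)))
  have hq : ∀ k, ∫ z in B..1, (z ^ (-t) - k) ^ 2 * z ^ t = (∫ z in B..1, z ^ (-t)) -
      2 * k * (1 - B) + k ^ 2 * ∫ z in B..1, z ^ t := fun k => by
    have h := integral_sq_rpow_add_const hB0 hB1 (-t) 1 (-k)
    simp only [one_mul, one_pow, neg_neg, ← sub_eq_add_neg] at h
    rw [h]
    ring
  simp only [hk, hq, Pi.sub_apply] at hM
  set P := ∫ z in B..1, z ^ t
  set W := ∫ z in B..1, z ^ (-t)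
  set A := ∫ z in B..1, v.2 z ^ 2 * z ^ (-t)
  set M := ∫ z in B..1, v.2 z * z ^ (-t)
  have hL : 0 < 1 - B := sub_pos.2 hB1
  have hA' : ((1 - B) / Real.sqrt (P * W)) ^ 2 * A ≤
      ∫ z in B..1, (v.2 z - M / W) ^ 2 * z ^ (-t) := by
    have h := hM ((1 - B) / P)
    rw [hE, div_pow, Real.sq_sqrt (by positivity)]
    have e1 : A - 2 * (M / W) * M + (M / W) ^ 2 * W = A - M ^ 2 / W := by field_simp; ring
    have e2 : A * (W - 2 * ((1 - B) / P) * (1 - B) + ((1 - B) / P) ^ 2 * P) / W =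
        A - (1 - B) ^ 2 / (P * W) * A := by field_simp; ring
    have h2 := div_le_div_of_nonneg_right h hW.le
    rw [e2] at h2
    rw [e1]
    linarith
  have hμ : 0 < (1 - B) / Real.sqrt (P * W) := by positivity
  set μ := (1 - B) / Real.sqrt (P * W)
  set c := M / W with hcdef
  set A' := ∫ z in B..1, (v.2 z - c) ^ 2 * z ^ (-t) with hA'def
  have hA'pos : 0 < A' := (by positivity : 0 < μ ^ 2 * A).trans_le hA'
  have hgc : ContinuousOn (fun z => (v.2 z - c) * z ^ (-t)) (Set.Icc B 1) :=
    (hc.sub continuousOn_const).mul hw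
  have hg0 : ∫ z in B..1, (v.2 z - c) * z ^ (-t) = 0 := by
    rw [hlin, hcdef, div_mul_cancel₀ _ hW.ne', sub_self]
  obtain ⟨ψ, hψ, hψg⟩ := exists_adm_of_integral_eq_zero hB1 hgc hg0 (by
    by_contra! h
    refine hA'pos.ne' ?_
    rw [hA'def, intervalIntegral_congr_Icc hB1 (g := fun _ => (0 : ℝ)) fun z hz => by
      rw [sq, mul_assoc, h z hz, mul_zero]]
    simp)
  refine ⟨ψ, hψ, ?_⟩
  have hN : ∫ z in B..1, v.2 z * ψ.2 z = A' := by
    have h1 : ∫ z in B..1, v.2 z * ψ.2 z =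
        ∫ z in B..1, ((v.2 z - c) ^ 2 * z ^ (-t) + c * ((v.2 z - c) * z ^ (-t))) :=
      intervalIntegral_congr_Icc hB1 fun z hz => by rw [hψg z hz]; ring
    have h2 : IntervalIntegrable (fun z => (v.2 z - c) ^ 2 * z ^ (-t)) volume B 1 :=
      (((hc.sub continuousOn_const).pow 2).mul hw).intervalIntegrable_of_Icc hB1.le
    rw [h1, intervalIntegral.integral_add h2
      ((hgc.intervalIntegrable_of_Icc hB1.le).const_mul _),
      intervalIntegral.integral_const_mul, hg0, mul_zero, add_zero]
  have hD : ∫ z in B..1, ψ.2 z ^ 2 * z ^ t = A' :=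
    intervalIntegral_congr_Icc hB1 fun z hz => by
      have := rpow_mul_rpow_neg_cancel (hB0.trans_le hz.1) t
      rw [hψg z hz]
      linear_combination (v.2 z - c) ^ 2 * z ^ (-t) * this
  rw [F0_eq_intervalIntegral hB1, hN, hD, le_div_iff₀ (by positivity)]
  have h1 : μ * Real.sqrt A ≤ Real.sqrt A' :=
    Real.le_sqrt_of_sq_le (by rwa [mul_pow, Real.sq_sqrt hA.le])
  calc μ * (Real.sqrt A * Real.sqrt A') = μ * Real.sqrt A * Real.sqrt A' := by ring
    _ ≤ Real.sqrt A' * Real.sqrt A' := by gcongr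
    _ = A' := Real.mul_self_sqrt hA'pos.le

/-- The function with derivative proportional to `P - (1 - B) z ^ t`, where `P = ∫ z ^ t`,
attains the min-max value. -/
lemma exists_adm_F0_le {B t : ℝ} (hB0 : 0 < B) (hB1 : B < 1) (ht0 : 0 < t) :
    ∃ v, Adm B v ∧ ∀ ψ, Adm B ψ →
      F0 B t v ψ ≤ (1 - B) / Real.sqrt ((∫ z in B..1, z ^ t) * ∫ z in B..1, z ^ (-t)) := by
  have hP := integral_rpow_pos hB0 hB1 t
  have hW := integral_rpow_pos hB0 hB1 (-t)
  have hw := continuousOn_rpow_Icc hB0 t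
  have hL : 0 < 1 - B := sub_pos.2 hB1
  have hquad := integral_sq_rpow_add_const hB0 hB1 t
  set P := ∫ z in B..1, z ^ t with hPdef
  set W := ∫ z in B..1, z ^ (-t)
  obtain ⟨v, hv, hva⟩ := exists_adm_of_integral_eq_zero hB1
    (g := fun z => -(1 - B) * z ^ t + P)
    ((continuousOn_const.mul hw).add continuousOn_const)
    (by
      rw [intervalIntegral.integral_add ((hw.intervalIntegrable_of_Icc hB1.le).const_mul _)
        intervalIntegrable_const, intervalIntegral.integral_const_mul,
        intervalIntegral.integral_const, smul_eq_mul, ← hPdef]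
      ring)
    (by
      by_contra! h
      have h1 := h 1 ⟨hB1.le, le_rfl⟩
      have h2 := h B ⟨le_rfl, hB1.le⟩
      have h3 : B ^ t < 1 := Real.rpow_lt_one hB0.le hB1 ht0
      rw [Real.one_rpow] at h1
      nlinarith)
  refine ⟨v, hv, fun ψ hψ => ?_⟩
  have hψc := hψ.2.1
  have hψ0 := hψ.integral_eq_zero hB1
  have hA : ∫ z in B..1, v.2 z ^ 2 * z ^ (-t) = P * (P * W - (1 - B) ^ 2) := by
    rw [intervalIntegral_congr_Icc hB1 fun z hz => by rw [hva z hz], hquad]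
    ring
  have hN : ∫ z in B..1, v.2 z * ψ.2 z =
      ∫ z in B..1, (-(1 - B) * z ^ t + (1 - B) ^ 2 / W) * ψ.2 z := by
    have h1 : ∫ z in B..1, v.2 z * ψ.2 z =
        ∫ z in B..1, ((-(1 - B) * z ^ t + (1 - B) ^ 2 / W) * ψ.2 z +
          (P - (1 - B) ^ 2 / W) * ψ.2 z) :=
      intervalIntegral_congr_Icc hB1 fun z hz => by rw [hva z hz]; ring
    have h2 : IntervalIntegrable
        (fun z => (-(1 - B) * z ^ t + (1 - B) ^ 2 / W) * ψ.2 z) volume B 1 :=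
      (((continuousOn_const.mul hw).add continuousOn_const).mul
        hψc).intervalIntegrable_of_Icc hB1.le
    rw [h1, intervalIntegral.integral_add h2
      ((hψc.intervalIntegrable_of_Icc hB1.le).const_mul _),
      intervalIntegral.integral_const_mul, hψ0, mul_zero, add_zero]
  have hCS := sq_integral_mul_le_rpow hB0 hB1 t
    (f := fun z => -(1 - B) * z ^ t + (1 - B) ^ 2 / W)
    ((continuousOn_const.mul hw).add continuousOn_const) hψc
  rw [hquad, ← hN] at hCS
  have hA0 : 0 ≤ ∫ z in B..1, v.2 z ^ 2 * z ^ (-t) :=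
    intervalIntegral.integral_nonneg hB1.le fun z hz =>
      mul_nonneg (sq_nonneg _) (Real.rpow_nonneg (hB0.le.trans hz.1) _)
  have hG0 : 0 ≤ ∫ z in B..1, ψ.2 z ^ 2 * z ^ t :=
    intervalIntegral.integral_nonneg hB1.le fun z hz =>
      mul_nonneg (sq_nonneg _) (Real.rpow_nonneg (hB0.le.trans hz.1) _)
  rw [F0_eq_intervalIntegral hB1]
  refine div_le_of_le_mul₀ (by positivity) (by positivity) ?_
  refine le_of_sq_le_sq ?_ (by positivity)
  rw [mul_pow, mul_pow, Real.sq_sqrt hA0, Real.sq_sqrt hG0, div_pow, Real.sq_sqrt (by positivity),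
    hA]
  refine hCS.trans_eq ?_
  field_simp
  ring

/-- Appendix D: the exact value `μ₀` of the one-dimensional, x-independent min-max
problem, with `μ₀² = (1-B)²(1-γ̃)(1+γ̃)/((1-B^{1-γ̃})(1-B^{1+γ̃}))` (eq. (6.2.4)). -/
theorem appendix_D (B t : ℝ) (hB0 : 0 < B) (hB1 : B < 1) (ht0 : 0 < t) (ht1 : t < 1) :
    ∃ μ₀ : ℝ, 0 < μ₀ ∧
      μ₀ ^ 2 = (1 - B) ^ 2 * (1 - t) * (1 + t) /
        ((1 - B ^ (1 - t)) * (1 - B ^ (1 + t))) ∧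
      (⨅ v : {p : (ℝ → ℝ) × (ℝ → ℝ) // Adm B p},
        ⨆ ψ : {p : (ℝ → ℝ) × (ℝ → ℝ) // Adm B p}, F0 B t v.1 ψ.1) = μ₀ := by
  have hP := integral_rpow_pos hB0 hB1 t
  have hW := integral_rpow_pos hB0 hB1 (-t)
  have hL : 0 < 1 - B := sub_pos.2 hB1
  refine ⟨(1 - B) / Real.sqrt ((∫ z in B..1, z ^ t) * ∫ z in B..1, z ^ (-t)), by positivity,
    ?_, ?_⟩
  · rw [div_pow, Real.sq_sqrt (by positivity), integral_rpow (Or.inl (by linarith)),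
      integral_rpow (Or.inl (by linarith)), Real.one_rpow, Real.one_rpow,
      show -t + 1 = 1 - t by ring, add_comm t 1]
    have h1 : B ^ (1 - t) < 1 := Real.rpow_lt_one hB0.le hB1 (by linarith)
    have h2 : B ^ (1 + t) < 1 := Real.rpow_lt_one hB0.le hB1 (by linarith)
    have h3 : 1 - B ^ (1 - t) ≠ 0 := by linarith
    have h4 : 1 - B ^ (1 + t) ≠ 0 := by linarith
    have h5 : 1 - t ≠ 0 := by linarith
    have h6 : 1 + t ≠ 0 := by linarith
    field_simp
  · obtain ⟨v₀, hv₀, hle⟩ := exists_adm_F0_le hB0 hB1 ht0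
    have hne : Nonempty {p : (ℝ → ℝ) × (ℝ → ℝ) // Adm B p} := ⟨⟨v₀, hv₀⟩⟩
    have hlower : ∀ v : {p : (ℝ → ℝ) × (ℝ → ℝ) // Adm B p},
        (1 - B) / Real.sqrt ((∫ z in B..1, z ^ t) * ∫ z in B..1, z ^ (-t)) ≤
          ⨆ ψ : {p : (ℝ → ℝ) × (ℝ → ℝ) // Adm B p}, F0 B t v.1 ψ.1 := fun v => by
      obtain ⟨ψ, hψ, h⟩ := exists_le_F0 hB0 hB1 t v.2
      refine h.trans (le_ciSup (f := fun ψ : {p : (ℝ → ℝ) × (ℝ → ℝ) // Adm B p} =>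
        F0 B t v.1 ψ.1) ⟨1, ?_⟩ ⟨ψ, hψ⟩)
      rintro _ ⟨φ, rfl⟩
      exact F0_le_one hB0 hB1 t v.2 φ.2
    refine le_antisymm ?_ (le_ciInf hlower)
    exact (ciInf_le ⟨_, Set.forall_mem_range.2 hlower⟩ ⟨v₀, hv₀⟩).trans
      (ciSup_le fun ψ => hle ψ.1 ψ.2)
end
end

section
/- Let α = 0.39, γ = 0.6, d = 0.1, e = 1.2, and set δ₊ := (α+1+γ)² − 1, δ₋ := (α+1−γ)² − 1, δ₀ := (α+1)² − γ² − 1. Then for all real s ≥ 0 and all t ∈ [0,1], the quantities 1 + d²s + δ₊t and 1 + e²s + δ₋t are strictly positive and (1 + s + δ₀ t) / √((1 + d²s + δ₊t)(1 + e²s + δ₋t)) ≥ (2√2 · 0.61)/(1 + α + γ) + 0.02. (Quantitative core of Proposition 6.4: the lower bound on the min-max constant strictly exceeds the comparison value 2√2·0.61/1.99) -/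
noncomputable section

/-- Quantitative core of Proposition 6.4: with `α = 0.39`, `γ = 0.6`, `d = 0.1`,
`e = 1.2`, `δ₊ = (α+1+γ)² − 1`, `δ₋ = (α+1−γ)² − 1`, `δ₀ = (α+1)² − γ² − 1`,
for all `s ≥ 0` and `t ∈ [0,1]` the two denominators are positive and
`(1 + s + δ₀ t)/√((1 + d²s + δ₊t)(1 + e²s + δ₋t)) ≥ 2√2·0.61/(1+α+γ) + 0.02`. -/
theorem prop_6_4_core :
    ∀ s : ℝ, 0 ≤ s → ∀ t : ℝ, t ∈ Set.Icc (0 : ℝ) 1 →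
      (0 < 1 + (0.1 : ℝ) ^ 2 * s + (((0.39 : ℝ) + 1 + 0.6) ^ 2 - 1) * t) ∧
      (0 < 1 + (1.2 : ℝ) ^ 2 * s + (((0.39 : ℝ) + 1 - 0.6) ^ 2 - 1) * t) ∧
      (2 * Real.sqrt 2 * 0.61) / (1 + 0.39 + 0.6) + 0.02 ≤
        (1 + s + (((0.39 : ℝ) + 1) ^ 2 - (0.6 : ℝ) ^ 2 - 1) * t) /
          Real.sqrt ((1 + (0.1 : ℝ) ^ 2 * s + (((0.39 : ℝ) + 1 + 0.6) ^ 2 - 1) * t) *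
            (1 + (1.2 : ℝ) ^ 2 * s + (((0.39 : ℝ) + 1 - 0.6) ^ 2 - 1) * t)) := by
  intro s hs t ⟨ht0, ht1⟩
  have hA : 0 < 1 + (0.1 : ℝ) ^ 2 * s + (((0.39 : ℝ) + 1 + 0.6) ^ 2 - 1) * t := by
    nlinarith
  have hB : 0 < 1 + (1.2 : ℝ) ^ 2 * s + (((0.39 : ℝ) + 1 - 0.6) ^ 2 - 1) * t := by
    nlinarith
  refine ⟨hA, hB, ?_⟩
  have hsqrt2 : √2 ≤ 1.41422 := Real.sqrt_le_iff.mpr (by norm_num)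
  have hK : (2 * √2 * 0.61) / (1 + 0.39 + 0.6) + 0.02 ≤ 0.8871 := by
    rw [← le_sub_iff_add_le, div_le_iff₀ (by norm_num)]
    linarith
  refine hK.trans ?_
  rw [le_div_iff₀ (Real.sqrt_pos.mpr (mul_pos hA hB)), mul_comm,
    ← le_div_iff₀ (by norm_num), Real.sqrt_le_iff]
  refine ⟨div_nonneg (by nlinarith) (by norm_num), ?_⟩
  rw [div_pow, le_div_iff₀ (by norm_num)]
  nlinarith [mul_nonneg ht0 (sub_nonneg.mpr ht1), sq_nonneg (1.9774 * s - 2.207 * t + 0.859)]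
end
end

section
/- For every real x ≠ 0 one has |(1 − cos x)/x| ≤ 0.73 and |(sin x)/x − 0.39| ≤ 0.61. (Bounds (5.3) and (5.4) on the nonlinearity coefficients) -/
/-- The bound `1 - cos x ≤ 0.73 x` on the nonnegative half-line. -/
lemma one_sub_cos_le_mul {x : ℝ} (hx : 0 ≤ x) : 1 - Real.cos x ≤ 0.73 * x := by
  have hπ := Real.pi_gt_d4
  have hπ' := Real.pi_lt_d4
  rcases le_total x 1.46 with h | h
  · nlinarith [Real.one_sub_sq_div_two_le_cos (x := x)]
  rcases le_total x (Real.pi / 2) with h1 | h1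
  · linarith [Real.cos_nonneg_of_mem_Icc ⟨by linarith, h1⟩]
  rcases le_total x (Real.pi / 2 + 0.5) with h2 | h2
  · have hs := Real.sin_le (x := x - Real.pi / 2) (by linarith)
    rw [Real.sin_sub_pi_div_two] at hs
    linarith
  rcases le_total 2.74 x with h3 | h3
  · linarith [Real.neg_one_le_cos x]
  obtain ⟨t, rfl⟩ : ∃ t, x = Real.pi / 4 + t + Real.pi / 2 :=
    ⟨x - Real.pi / 4 - Real.pi / 2, by ring⟩
  have ht : |t| ≤ 1 / 2 := abs_le.2 ⟨by linarith, by linarith⟩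
  have hc := (abs_le.1 (Real.cos_bound (ht.trans (by norm_num)))).2
  have hs := (abs_le.1 (Real.sin_bound (ht.trans (by norm_num)))).2
  have habs : |t| ^ 4 = t ^ 4 := Even.pow_abs (by decide) t
  have hpow : |t| ^ 5 ≤ t ^ 4 :=
    habs ▸ pow_le_pow_of_le_one (abs_nonneg t) (ht.trans (by norm_num)) (by norm_num)
  rw [habs] at hc
  obtain ⟨ht1, ht2⟩ := abs_le.1 ht
  have hsum : Real.sin t + Real.cos t ≤ 1 + t := by
    have : 0 ≤ t ^ 2 * (1 / 2 + t / 6 - t ^ 2 * (5 / 96 + 1 / 100)) :=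
      mul_nonneg (sq_nonneg t) (by nlinarith)
    nlinarith
  have hr : √2 ≤ 1.4144 := Real.sqrt_le_iff.2 (by norm_num)
  rw [Real.cos_add_pi_div_two, Real.sin_add, Real.sin_pi_div_four, Real.cos_pi_div_four]
  nlinarith [mul_le_mul_of_nonneg_left hsum (Real.sqrt_nonneg 2),
    mul_le_mul_of_nonneg_right hr (by linarith : 0 ≤ 1 + t)]

/-- The bound `-0.22 x ≤ sin x` on the nonnegative half-line. -/
lemma neg_mul_le_sin {x : ℝ} (hx : 0 ≤ x) : -(0.22 * x) ≤ Real.sin x := by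
  have hπ := Real.pi_gt_d4
  have hπ' := Real.pi_lt_d4
  rcases le_total x Real.pi with h | h
  · linarith [Real.sin_nonneg_of_nonneg_of_le_pi hx h]
  rcases le_total 4.55 x with h1 | h1
  · linarith [Real.neg_one_le_sin x]
  obtain ⟨k, rfl⟩ : ∃ k, x = Real.pi / 2 - k + Real.pi :=
    ⟨Real.pi / 2 + Real.pi - x, by ring⟩
  rw [Real.sin_add_pi, Real.sin_pi_div_two_sub]
  have hk : 0 ≤ k := by linarith
  rcases le_total k 1 with h2 | h2
  · have hc := (abs_le.1 (Real.cos_bound (abs_le.2 ⟨by linarith, h2⟩))).2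
    rw [abs_of_nonneg hk] at hc
    have : k ^ 4 ≤ k ^ 2 := pow_le_pow_of_le_one hk h2 (by norm_num)
    nlinarith [sq_nonneg (k - 0.245)]
  · have := Real.cos_le_cos_of_nonneg_of_le_pi zero_le_one (by linarith) h2
    linarith [Real.cos_one_le]

/-- Bounds (5.3) and (5.4) on the nonlinearity coefficients:
`|(1 − cos x)/x| ≤ 0.73` and `|(sin x)/x − 0.39| ≤ 0.61` for all real `x ≠ 0`. -/
theorem coefficient_bounds (x : ℝ) (hx : x ≠ 0) :
    |(1 - Real.cos x) / x| ≤ 0.73 ∧ |Real.sin x / x - 0.39| ≤ 0.61 := by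
  wlog hpos : 0 < x generalizing x
  · have := this (-x) (neg_ne_zero.2 hx) (neg_pos.2 (lt_of_le_of_ne (not_lt.1 hpos) hx))
    rwa [Real.cos_neg, Real.sin_neg, div_neg, abs_neg, neg_div_neg_eq] at this
  constructor
  · rw [abs_of_nonneg (div_nonneg (by linarith [Real.cos_le_one x]) hpos.le), div_le_iff₀ hpos]
    exact one_sub_cos_le_mul hpos.le
  · have hlow : -0.22 ≤ Real.sin x / x := by
      rw [le_div_iff₀ hpos]
      linarith [neg_mul_le_sin hpos.le]
    have hup : Real.sin x / x ≤ 1 := (div_le_one hpos).2 (Real.sin_le hpos.le)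
    exact abs_le.2 ⟨by linarith, by linarith⟩
end

section
/- Let R > 1, K > 0, and let φ, φ̂ : ℝ → ℝ be continuous, 2π-periodic, odd functions satisfying |φ(ϑ)| ≤ K|sin ϑ| and |φ̂(ϑ)| ≤ K|sin ϑ| for all ϑ. Then there exists a function Φ : closure(A_R) → ℝ such that: Φ is continuous on closure(A_R); Φ is twice continuously differentiable on A_R with ∂²Φ/∂ζ² + ∂²Φ/∂ρ² = 0 on A_R; Φ is antisymmetric (Φ(ζ,−ρ) = −Φ(ζ,ρ)); Φ(cos ϑ, sin ϑ) = φ(ϑ) and Φ(R cos ϑ, R sin ϑ) = φ̂(ϑ) for all ϑ; and |Φ(ζ,ρ)| ≤ K·|ρ|/√(ζ²+ρ²) for all (ζ,ρ) ∈ A_R (with the same K, independently of R). Moreover Φ is the unique continuous function on closure(A_R), harmonic in A_R, with these boundary values. (Proposition B.1, harmonic interpolation of boundary data) -/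
noncomputable section

/-- The open annulus `1 < ζ² + ρ² < R²` in the (ζ,ρ)-plane. -/
def annulus (R : ℝ) : Set (ℝ × ℝ) :=
  {p | 1 < p.1 ^ 2 + p.2 ^ 2 ∧ p.1 ^ 2 + p.2 ^ 2 < R ^ 2}

/-- `Φ` is harmonic on the annulus: twice continuously differentiable with vanishing
Laplacian `∂²Φ/∂ζ² + ∂²Φ/∂ρ² = 0`. -/
def HarmonicOnAnnulus (R : ℝ) (Φ : ℝ × ℝ → ℝ) : Prop :=
  ContDiffOn ℝ 2 Φ (annulus R) ∧
  ∀ p ∈ annulus R,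
    fderiv ℝ (fun q => fderiv ℝ Φ q (1, 0)) p (1, 0) +
      fderiv ℝ (fun q => fderiv ℝ Φ q (0, 1)) p (0, 1) = 0

open InnerProductSpace Filter Topology Metric

/-- The weak maximum principle for harmonic functions on an open subset of a compact set. -/
theorem nonpos_of_harmonicOnNhd {C U : Set ℂ} {f : ℂ → ℝ} (hC : IsCompact C) (hU : IsOpen U)
    (hUC : U ⊆ C) (hfc : ContinuousOn f C) (hf : HarmonicOnNhd f U)
    (hbd : ∀ z ∈ C \ U, f z ≤ 0) : ∀ z ∈ C, f z ≤ 0 := by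
  intro z hz
  obtain ⟨m, hmC, hm⟩ := hC.exists_isMaxOn ⟨z, hz⟩ hfc
  have hclosed : IsCompact {w ∈ C | f w = f m} := by
    refine hC.of_isClosed_subset ?_ fun w hw => hw.1
    exact hfc.preimage_isClosed_of_isClosed hC.isClosed (isClosed_singleton (x := f m))
  obtain ⟨w, ⟨hwC, hwm⟩, hw⟩ :=
    hclosed.exists_isMaxOn ⟨m, hmC, rfl⟩ Complex.continuous_re.continuousOn
  suffices w ∉ U from (hm hz).trans (hwm ▸ hbd w ⟨hwC, this⟩)
  intro hwU
  obtain ⟨r, hr, hball⟩ := Metric.isOpen_iff.1 hU w hwU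
  obtain ⟨F, hF, hFf⟩ := (hf.mono hball).exists_analyticOnNhd_ball_re_eq
  have hnhds : ball w r ∈ 𝓝 w := ball_mem_nhds w hr
  have hconst : ∀ᶠ y in 𝓝 w, Complex.exp (F y) = Complex.exp (F w) := by
    refine Complex.eventually_eq_of_isLocalMax_norm (f := fun y => Complex.exp (F y)) ?_ ?_
    · filter_upwards [hnhds] with y hy using (hF y hy).differentiableAt.cexp
    · filter_upwards [hnhds] with y hy
      have h1 := hFf hy
      have h2 := hFf (mem_ball_self hr)
      simp only at h1 h2
      simp only [Function.comp, Complex.norm_exp, h1, h2, Real.exp_le_exp, hwm]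
      exact hm (hUC (hball hy))
  obtain ⟨s, hs, hsub⟩ := Metric.eventually_nhds_iff_ball.1 (hconst.and hnhds)
  have hy : w + (s / 2 : ℝ) ∈ ball w s := by
    rw [mem_ball_iff_norm, add_sub_cancel_left, Complex.norm_real, Real.norm_of_nonneg] <;> linarith
  obtain ⟨hexp, hyr⟩ := hsub _ hy
  have hval : f (w + (s / 2 : ℝ)) = f w := by
    rw [← hFf hyr, ← hFf (mem_ball_self hr)]
    apply Real.exp_injective
    simp only [← Complex.norm_exp, hexp]
  have := hw (show w + (s / 2 : ℝ) ∈ {w ∈ C | f w = f m} from ⟨hUC (hball hyr), hval.trans hwm⟩)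
  simp only [Set.mem_ofPred_eq, Complex.add_re, Complex.ofReal_re] at this
  linarith

/-- Harmonic functions agreeing on the boundary agree everywhere. -/
theorem eqOn_of_harmonicOnNhd {C U : Set ℂ} {f g : ℂ → ℝ} (hC : IsCompact C) (hU : IsOpen U)
    (hUC : U ⊆ C) (hfc : ContinuousOn f C) (hgc : ContinuousOn g C) (hf : HarmonicOnNhd f U)
    (hg : HarmonicOnNhd g U) (hbd : Set.EqOn f g (C \ U)) : Set.EqOn f g C := fun z hz =>
  le_antisymm
    (sub_nonpos.1 (nonpos_of_harmonicOnNhd hC hU hUC (hfc.sub hgc) (hf.sub hg)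
      (fun w hw => by simp [hbd hw]) z hz))
    (sub_nonpos.1 (nonpos_of_harmonicOnNhd hC hU hUC (hgc.sub hfc) (hg.sub hf)
      (fun w hw => by simp [hbd hw]) z hz))

/-- A uniform limit of harmonic functions on an open subset of the plane is harmonic. -/
theorem harmonicOnNhd_of_tendstoUniformlyOn {U : Set ℂ} {F : ℕ → ℂ → ℝ} {f : ℂ → ℝ}
    (hU : IsOpen U) (hF : ∀ n, HarmonicOnNhd (F n) U) (hlim : TendstoUniformlyOn F f atTop U) :
    HarmonicOnNhd f U := by
  intro c hc
  obtain ⟨r, hr, hball⟩ := Metric.nhds_basis_closedBall.mem_iff.1 (hU.mem_nhds hc)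
  have hfc : ContinuousOn f U :=
    hlim.continuousOn (Frequently.of_forall fun n => (hF n).continuousOn)
  have hsphere : sphere c r ⊆ U := sphere_subset_closedBall.trans hball
  have hmaps : Set.MapsTo (fun z : ℂ => z + c) (sphere 0 r) (sphere c r) := by
    intro z hz
    simpa using hz
  have hshift : ∀ g : ℂ → ℝ, ContinuousOn g U → ContinuousOn (fun z => g (z + c)) (sphere 0 r) :=
    fun g hg => hg.comp (by fun_prop) (hmaps.mono_right hsphere)
  have hint := (hshift f hfc).circleIntegrable hr.le
  have key : ∀ w ∈ ball c r,
      f w = (Real.circleAverage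
        (fun ζ => herglotzRieszKernel 0 (w - c) ζ • (f (ζ + c) : ℂ)) 0 r).re := by
    intro w hw
    have hw' : w - c ∈ ball 0 r := by simpa using mem_ball_iff_norm.1 hw
    rw [re_circleAverage_herglotzRieszKernel_smul hint hw']
    have hP : ∀ n, F n w = Real.circleAverage
        ((Complex.re ∘ herglotzRieszKernel 0 (w - c)) • fun z => F n (z + c)) 0 r := by
      intro n
      rw [← ((hF n).mono hball).circleAverage_re_herglotzRieszKernel_smul hw,
        ← Real.circleAverage_map_add_const]
      congr 1
      ext z
      simp [herglotzRieszKernel_add_const]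
    have hk : ContinuousOn (Complex.re ∘ herglotzRieszKernel 0 (w - c)) (sphere 0 r) :=
      Complex.continuous_re.comp_continuousOn (by
        simpa [abs_of_pos hr] using continuousOn_herglotzRieszKernel_sphere hw')
    refine tendsto_nhds_unique (hlim.tendsto_at (hball (ball_subset_closedBall hw))) ?_
    simp only [hP]
    obtain ⟨M, hM⟩ := (isCompact_sphere (0 : ℂ) r).exists_bound_of_continuousOn hk
    obtain ⟨B, hB⟩ := (isCompact_sphere (0 : ℂ) r).exists_bound_of_continuousOn (hshift f hfc)
    unfold Real.circleAverage
    refine Tendsto.const_smul ?_ _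
    have hmem : ∀ θ, circleMap 0 r θ ∈ sphere (0 : ℂ) r := fun θ => circleMap_mem_sphere 0 hr.le θ
    refine intervalIntegral.tendsto_integral_filter_of_dominated_convergence
      (fun _ => M * (1 + B)) ?_ ?_ intervalIntegrable_const ?_
    · refine Eventually.of_forall fun n => Continuous.aestronglyMeasurable ?_
      exact (hk.smul (hshift _ (hF n).continuousOn)).comp_continuous (continuous_circleMap 0 r) hmem
    · filter_upwards [Metric.tendstoUniformlyOn_iff.1 hlim 1 one_pos] with n hn
      refine Eventually.of_forall fun θ _ => ?_
      have h1 := hn _ (hsphere (hmaps (hmem θ)))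
      have h2 := hB _ (hmem θ)
      have h3 := hM _ (hmem θ)
      rw [Pi.smul_apply', norm_smul]
      refine mul_le_mul h3 ?_ (norm_nonneg _) ((norm_nonneg _).trans h3)
      rw [Real.dist_eq] at h1
      simp only [Real.norm_eq_abs] at h2 ⊢
      grind
    · refine Eventually.of_forall fun θ _ => ?_
      exact tendsto_const_nhds.mul (hlim.tendsto_at (hsphere (hmaps (hmem θ))))
  have hG : AnalyticAt ℂ (fun w => Real.circleAverage
      (fun ζ => herglotzRieszKernel 0 (w - c) ζ • (f (ζ + c) : ℂ)) 0 r) c := by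
    have hd : DifferentiableOn ℂ (fun w => Real.circleAverage
        (fun ζ => herglotzRieszKernel 0 w ζ • (f (ζ + c) : ℂ)) 0 r) (ball 0 r) := fun w hw =>
      (hasDerivAt_circleAverage_herglotzRieszKernel_smul
        ((Complex.continuous_ofReal.comp_continuousOn (hshift f hfc)).circleIntegrable hr.le)
        hw).differentiableAt.differentiableWithinAt
    have h0 : AnalyticAt ℂ (fun w => Real.circleAverage
        (fun ζ => herglotzRieszKernel 0 w ζ • (f (ζ + c) : ℂ)) 0 r) (c - c) := by
      rw [sub_self]
      exact hd.analyticAt (ball_mem_nhds (0 : ℂ) hr)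
    exact h0.fun_comp (f := fun w => w - c) (analyticAt_id.sub analyticAt_const)
  refine (harmonicAt_congr_nhds ?_).2 hG.harmonicAt_re
  filter_upwards [ball_mem_nhds c hr] with w hw using key w hw

/-- The open annulus `1 < ‖z‖ < R` in the complex plane. -/
def complexAnnulus (R : ℝ) : Set ℂ := {z | 1 < ‖z‖ ∧ ‖z‖ < R}

/-- The closed annulus `1 ≤ ‖z‖ ≤ R` in the complex plane. -/
def closedComplexAnnulus (R : ℝ) : Set ℂ := {z | 1 ≤ ‖z‖ ∧ ‖z‖ ≤ R}

theorem isOpen_complexAnnulus (R : ℝ) : IsOpen (complexAnnulus R) :=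
  (isOpen_lt continuous_const continuous_norm).inter (isOpen_lt continuous_norm continuous_const)

theorem isCompact_closedComplexAnnulus (R : ℝ) : IsCompact (closedComplexAnnulus R) := by
  refine (isCompact_closedBall (0 : ℂ) R).of_isClosed_subset ?_ fun z hz => by simpa using hz.2
  exact (isClosed_le continuous_const continuous_norm).inter
    (isClosed_le continuous_norm continuous_const)

theorem complexAnnulus_subset (R : ℝ) : complexAnnulus R ⊆ closedComplexAnnulus R :=
  fun _ hz => ⟨hz.1.le, hz.2.le⟩

theorem exp_mem_closedComplexAnnulus {R : ℝ} (hR : 1 < R) (θ : ℝ) :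
    Complex.exp (θ * Complex.I) ∈ closedComplexAnnulus R := by
  simp [closedComplexAnnulus, Complex.norm_exp_ofReal_mul_I, hR.le]

theorem mul_exp_mem_closedComplexAnnulus {R : ℝ} (hR : 1 < R) (θ : ℝ) :
    (R : ℂ) * Complex.exp (θ * Complex.I) ∈ closedComplexAnnulus R := by
  simp [closedComplexAnnulus, Complex.norm_exp_ofReal_mul_I,
    abs_of_pos (zero_lt_one.trans hR), hR.le]

theorem exists_exp_eq_of_mem_diff {R : ℝ} {z : ℂ}
    (hz : z ∈ closedComplexAnnulus R \ complexAnnulus R) :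
    (∃ θ : ℝ, z = Complex.exp (θ * Complex.I)) ∨
      ∃ θ : ℝ, z = R * Complex.exp (θ * Complex.I) := by
  obtain ⟨⟨h1, h2⟩, h3⟩ := hz
  have hz' := Complex.norm_mul_exp_arg_mul_I z
  rcases h1.eq_or_lt with h | h
  · left
    exact ⟨z.arg, by rw [← h] at hz'; simpa using hz'.symm⟩
  · right
    have : ‖z‖ = R := le_antisymm h2 (not_lt.1 fun h' => h3 ⟨h, h'⟩)
    exact ⟨z.arg, by rw [this] at hz'; exact hz'.symm⟩

/-- `u` solves the Dirichlet problem on the annulus `1 < ‖z‖ < R`, with values `f` on the inner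
and `g` on the outer circle, both parametrized by the angle. -/
structure IsDirichletSolution (R : ℝ) (f g : ℝ → ℝ) (u : ℂ → ℝ) : Prop where
  continuousOn : ContinuousOn u (closedComplexAnnulus R)
  harmonicOnNhd : HarmonicOnNhd u (complexAnnulus R)
  inner_eq : ∀ θ : ℝ, u (Complex.exp (θ * Complex.I)) = f θ
  outer_eq : ∀ θ : ℝ, u (R * Complex.exp (θ * Complex.I)) = g θ

namespace IsDirichletSolution

variable {R : ℝ} {f g f' g' : ℝ → ℝ} {u u' : ℂ → ℝ}

theorem add (h : IsDirichletSolution R f g u) (h' : IsDirichletSolution R f' g' u') :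
    IsDirichletSolution R (f + f') (g + g') (u + u') where
  continuousOn := h.continuousOn.add h'.continuousOn
  harmonicOnNhd := h.harmonicOnNhd.add h'.harmonicOnNhd
  inner_eq θ := by simp [h.inner_eq, h'.inner_eq]
  outer_eq θ := by simp [h.outer_eq, h'.outer_eq]

theorem sub_le {ε : ℝ} (h : IsDirichletSolution R f g u) (h' : IsDirichletSolution R f' g' u')
    (hf : ∀ θ, f θ - f' θ ≤ ε) (hg : ∀ θ, g θ - g' θ ≤ ε) :
    ∀ z ∈ closedComplexAnnulus R, u z - u' z ≤ ε := by
  intro z hz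
  refine sub_nonpos.1 (nonpos_of_harmonicOnNhd (f := fun z => u z - u' z - ε)
    (isCompact_closedComplexAnnulus R)
    (isOpen_complexAnnulus R) (complexAnnulus_subset R)
    ((h.continuousOn.sub h'.continuousOn).sub continuousOn_const)
    ((h.harmonicOnNhd.sub h'.harmonicOnNhd).sub (harmonicOnNhd_const ε)) ?_ z hz)
  intro w hw
  rcases exists_exp_eq_of_mem_diff hw with ⟨θ, rfl⟩ | ⟨θ, rfl⟩
  · simpa [h.inner_eq, h'.inner_eq] using hf θ
  · simpa [h.outer_eq, h'.outer_eq] using hg θ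

theorem dist_le {ε : ℝ} (h : IsDirichletSolution R f g u) (h' : IsDirichletSolution R f' g' u')
    (hf : ∀ θ, dist (f θ) (f' θ) ≤ ε) (hg : ∀ θ, dist (g θ) (g' θ) ≤ ε) :
    ∀ z ∈ closedComplexAnnulus R, dist (u z) (u' z) ≤ ε := by
  simp only [Real.dist_eq, abs_sub_le_iff] at *
  exact fun z hz => ⟨h.sub_le h' (fun θ => (hf θ).1) (fun θ => (hg θ).1) z hz,
    h'.sub_le h (fun θ => (hf θ).2) (fun θ => (hg θ).2) z hz⟩

/-- The solution of the Dirichlet problem is unique. -/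
theorem eqOn (h : IsDirichletSolution R f g u) (h' : IsDirichletSolution R f g u') :
    Set.EqOn u u' (closedComplexAnnulus R) := fun z hz =>
  dist_le_zero.1 (h.dist_le h' (by simp) (by simp) z hz)

/-- Solvability of the Dirichlet problem passes to uniform limits of the boundary data. -/
theorem exists_of_tendstoUniformly (hR : 1 < R) {F G : ℕ → ℝ → ℝ} {V : ℕ → ℂ → ℝ}
    (hV : ∀ n, IsDirichletSolution R (F n) (G n) (V n))
    (hF : TendstoUniformly F f atTop) (hG : TendstoUniformly G g atTop) :
    ∃ v, IsDirichletSolution R f g v := by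
  have hcauchy : UniformCauchySeqOn V atTop (closedComplexAnnulus R) := by
    rw [Metric.uniformCauchySeqOn_iff]
    intro ε hε
    obtain ⟨N, hN⟩ := eventually_atTop.1
      ((Metric.tendstoUniformly_iff.1 hF (ε / 3) (by positivity)).and
        (Metric.tendstoUniformly_iff.1 hG (ε / 3) (by positivity)))
    refine ⟨N, fun m hm n hn z hz => lt_of_le_of_lt
      ((hV m).dist_le (hV n) (ε := ε / 3 + ε / 3) (fun θ => ?_) (fun θ => ?_) z hz) (by linarith)⟩
    · exact (dist_triangle_left _ _ (f θ)).trans (add_le_add ((hN m hm).1 θ).le ((hN n hn).1 θ).le)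
    · exact (dist_triangle_left _ _ (g θ)).trans (add_le_add ((hN m hm).2 θ).le ((hN n hn).2 θ).le)
  have hlim : ∀ z, ∃ y, z ∈ closedComplexAnnulus R → Tendsto (fun n => V n z) atTop (𝓝 y) := by
    intro z
    by_cases hz : z ∈ closedComplexAnnulus R
    · obtain ⟨y, hy⟩ := cauchySeq_tendsto_of_complete (hcauchy.cauchySeq hz)
      exact ⟨y, fun _ => hy⟩
    · exact ⟨0, fun h => absurd h hz⟩
  choose v hv using hlim
  have hunif := hcauchy.tendstoUniformlyOn_of_tendsto hv
  refine ⟨v, hunif.continuousOn (Frequently.of_forall fun n => (hV n).continuousOn),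
    harmonicOnNhd_of_tendstoUniformlyOn (isOpen_complexAnnulus R) (fun n => (hV n).harmonicOnNhd)
      (hunif.mono (complexAnnulus_subset R)), fun θ => ?_, fun θ => ?_⟩
  · refine tendsto_nhds_unique (hv _ (exp_mem_closedComplexAnnulus hR θ)) ?_
    simpa only [(hV _).inner_eq] using hF.tendsto_at θ
  · refine tendsto_nhds_unique (hv _ (mul_exp_mem_closedComplexAnnulus hR θ)) ?_
    simpa only [(hV _).outer_eq] using hG.tendsto_at θ

/-- The Dirichlet problem with a single Fourier mode on each boundary circle is solvable. -/
theorem exists_fourier (hR : 1 < R) (n : ℤ) (c d : ℂ) :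
    ∃ v, IsDirichletSolution R (fun θ => (c * Complex.exp (n * θ * Complex.I)).re)
      (fun θ => (d * Complex.exp (n * θ * Complex.I)).re) v := by
  have hne : ∀ z ∈ closedComplexAnnulus R, z ≠ 0 := fun z hz h0 => by
    have := hz.1
    simp [h0] at this
    linarith
  have hR0 : 0 < R := by linarith
  suffices ∃ v, HarmonicOnNhd v (closedComplexAnnulus R) ∧
      (∀ θ : ℝ, v (Complex.exp (θ * Complex.I)) = (c * Complex.exp (n * θ * Complex.I)).re) ∧
      ∀ θ : ℝ, v (R * Complex.exp (θ * Complex.I)) = (d * Complex.exp (n * θ * Complex.I)).re by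
    obtain ⟨v, hv, h1, h2⟩ := this
    exact ⟨v, hv.continuousOn, hv.mono (complexAnnulus_subset R), h1, h2⟩
  rcases eq_or_ne n 0 with rfl | hn
  · refine ⟨(fun _ => c.re) + ((d.re - c.re) / Real.log R) • fun z => Real.log ‖z‖,
      (harmonicOnNhd_const _).add (HarmonicOnNhd.const_smul fun z hz =>
        analyticAt_id.harmonicAt_log_norm (hne z hz)), fun θ => ?_, fun θ => ?_⟩
    · simp [Complex.norm_exp_ofReal_mul_I]
    · have := (Real.log_pos hR).ne'
      simp [Complex.norm_exp_ofReal_mul_I, abs_of_pos hR0, this]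
  · set Q : ℂ := (R : ℂ) ^ n with hQ
    have hQ0 : Q ≠ 0 := zpow_ne_zero _ (by exact_mod_cast hR0.ne')
    have hQ2 : Q ^ 2 - 1 ≠ 0 := by
      intro h
      have h2 : R ^ (n * 2) = 1 := by
        have : ((R : ℂ)) ^ (n * 2) = 1 := by
          rw [zpow_mul, ← hQ]; exact sub_eq_zero.1 h
        exact_mod_cast this
      rcases (zpow_eq_one_iff_right₀ hR0.le hR.ne').1 h2 with h
      omega
    set β : ℂ := (starRingEnd ℂ) ((c * Q - d) * Q / (Q ^ 2 - 1)) with hβ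
    set α : ℂ := (d * Q - c) / (Q ^ 2 - 1) with hα
    have key : ∀ (r : ℝ) (θ : ℝ), (α * (r * Complex.exp (θ * Complex.I)) ^ n +
        β * (r * Complex.exp (θ * Complex.I)) ^ (-n)).re =
        ((α * (r : ℂ) ^ n + (starRingEnd ℂ) β * (r : ℂ) ^ (-n)) *
          Complex.exp (n * θ * Complex.I)).re := by
      intro r θ
      have e1 : Complex.exp (θ * Complex.I) ^ n = Complex.exp (n * θ * Complex.I) := by
        rw [← Complex.exp_int_mul, mul_assoc]
      have e2 : Complex.exp (θ * Complex.I) ^ (-n) =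
          (starRingEnd ℂ) (Complex.exp (n * θ * Complex.I)) := by
        rw [← Complex.exp_int_mul, ← Complex.exp_conj]
        simp
        ring_nf
      rw [mul_zpow, mul_zpow, e1, e2, add_mul, Complex.add_re, Complex.add_re, ← mul_assoc,
        ← Complex.conj_re (β * _)]
      simp only [map_mul, Complex.conj_conj, map_zpow₀, Complex.conj_ofReal]
      ring_nf
    refine ⟨fun z => (α * z ^ n + β * z ^ (-n)).re, fun z hz => ?_, fun θ => ?_, fun θ => ?_⟩
    · exact ((analyticAt_const.mul (analyticAt_id.zpow (hne z hz))).add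
        (analyticAt_const.mul (analyticAt_id.zpow (hne z hz)))).harmonicAt_re
    · have := key 1 θ
      simp only [Complex.ofReal_one, one_mul, one_zpow, mul_one] at this
      refine this.trans ?_
      rw [hβ, hα, Complex.conj_conj]
      congr 2
      field_simp
      ring
    · refine (key R θ).trans ?_
      rw [hβ, hα, Complex.conj_conj, zpow_neg, ← hQ]
      congr 2
      field_simp
      ring

end IsDirichletSolution

instance : Fact (0 < 2 * Real.pi) := ⟨Real.two_pi_pos⟩

/-- The Dirichlet problem on the annulus is solvable for continuous boundary data. The set of
admissible complex-valued data `f`, multiplied by fixed constants on the two circles, is a closed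
subspace containing all Fourier modes. -/
theorem exists_isDirichletSolution_smul {R : ℝ} (hR : 1 < R) (a b : ℂ)
    (f : C(AddCircle (2 * Real.pi), ℂ)) :
    ∃ v, IsDirichletSolution R (fun θ => (a * f θ).re) (fun θ => (b * f θ).re) v := by
  let S : Submodule ℂ C(AddCircle (2 * Real.pi), ℂ) :=
    { carrier := {f | ∀ c : ℂ, ∃ v, IsDirichletSolution R (fun θ => (c * a * f θ).re)
        (fun θ => (c * b * f θ).re) v}
      add_mem' := by
        intro f g hf hg c
        obtain ⟨v, hv⟩ := hf c
        obtain ⟨w, hw⟩ := hg c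
        refine ⟨v + w, ?_⟩
        convert hv.add hw using 1 <;> ext θ <;>
          simp only [ContinuousMap.add_apply, Pi.add_apply, mul_add, Complex.add_re]
      zero_mem' := fun c => ⟨0, continuousOn_const, harmonicOnNhd_const 0, by simp, by simp⟩
      smul_mem' := by
        intro c f hf d
        obtain ⟨v, hv⟩ := hf (d * c)
        refine ⟨v, ?_⟩
        convert hv using 1 <;> ext θ <;>
          simp only [ContinuousMap.smul_apply, smul_eq_mul] <;> ring_nf }
  have hclosed : IsClosed (S : Set C(AddCircle (2 * Real.pi), ℂ)) := by
    refine isSeqClosed_iff_isClosed.1 fun F f hF hlim c => ?_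
    choose V hV using fun n => hF n c
    have hunif := ContinuousMap.tendsto_iff_tendstoUniformly.1 hlim
    have hcomp : ∀ k : ℂ, TendstoUniformly (fun n (θ : ℝ) => (k * F n θ).re)
        (fun θ : ℝ => (k * f θ).re) atTop := fun k =>
      (((Complex.reCLM.uniformContinuous.comp
        (ContinuousLinearMap.mul ℂ ℂ k).uniformContinuous).comp_tendstoUniformly hunif).comp
        (fun θ : ℝ => (θ : AddCircle (2 * Real.pi))))
    exact IsDirichletSolution.exists_of_tendstoUniformly hR hV (hcomp _) (hcomp _)
  have htop : S = ⊤ := by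
    rw [eq_top_iff, ← span_fourier_closure_eq_top]
    refine Submodule.topologicalClosure_minimal _ (Submodule.span_le.2 ?_) hclosed
    rintro _ ⟨n, rfl⟩ c
    have hmode : ∀ θ : ℝ, fourier n (θ : AddCircle (2 * Real.pi)) =
        Complex.exp (n * θ * Complex.I) := by
      intro θ
      rw [fourier_coe_apply]
      congr 1
      push_cast
      have : (Real.pi : ℂ) ≠ 0 := by exact_mod_cast Real.pi_ne_zero
      field_simp
    simp only [hmode]
    exact IsDirichletSolution.exists_fourier hR n _ _
  have hf : f ∈ S := htop ▸ Submodule.mem_top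
  simpa using hf 1

theorem exists_isDirichletSolution {R : ℝ} (hR : 1 < R) {f g : ℝ → ℝ} (hf : Continuous f)
    (hg : Continuous g) (hfp : Function.Periodic f (2 * Real.pi))
    (hgp : Function.Periodic g (2 * Real.pi)) : ∃ u, IsDirichletSolution R f g u := by
  have lift : ∀ h : ℝ → ℝ, Continuous h → Function.Periodic h (2 * Real.pi) →
      ∃ k : C(AddCircle (2 * Real.pi), ℂ), ∀ θ : ℝ, k θ = h θ := fun h hc hp =>
    ⟨⟨fun x => (hp.lift x : ℂ),
      Complex.continuous_ofReal.comp (continuous_coinduced_dom.2 hc)⟩, fun θ => rfl⟩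
  obtain ⟨F, hF⟩ := lift f hf hfp
  obtain ⟨G, hG⟩ := lift g hg hgp
  obtain ⟨u, hu⟩ := exists_isDirichletSolution_smul hR 1 0 F
  obtain ⟨v, hv⟩ := exists_isDirichletSolution_smul hR 0 1 G
  refine ⟨u + v, ?_⟩
  convert hu.add hv using 1 <;> ext θ <;> simp [hF, hG]

/-- The identification of `ℝ × ℝ` with the complex plane. -/
def planeEquiv : (ℝ × ℝ) ≃L[ℝ] ℂ := Complex.equivRealProdCLM.symm

theorem planeEquiv_apply (p : ℝ × ℝ) : planeEquiv p = ⟨p.1, p.2⟩ :=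
  Complex.ext (by simp [planeEquiv]) (by simp [planeEquiv])

theorem norm_planeEquiv (p : ℝ × ℝ) : ‖planeEquiv p‖ = √(p.1 ^ 2 + p.2 ^ 2) := by
  rw [planeEquiv_apply, Complex.norm_eq_sqrt_sq_add_sq]

theorem planeEquiv_mem_complexAnnulus {R : ℝ} (hR : 1 < R) {p : ℝ × ℝ} :
    planeEquiv p ∈ complexAnnulus R ↔ p ∈ annulus R := by
  change (1 < ‖planeEquiv p‖ ∧ ‖planeEquiv p‖ < R) ↔ _
  rw [norm_planeEquiv, Real.lt_sqrt zero_le_one, Real.sqrt_lt' (by linarith), one_pow]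
  rfl

theorem isOpen_annulus (R : ℝ) : IsOpen (annulus R) :=
  (isOpen_lt (f := fun _ : ℝ × ℝ => (1 : ℝ)) (by fun_prop) (by fun_prop)).inter
    (isOpen_lt (g := fun _ : ℝ × ℝ => R ^ 2) (by fun_prop) (by fun_prop))

theorem planeEquiv_mem_of_mem_closure {R : ℝ} (hR : 1 < R) {p : ℝ × ℝ}
    (hp : p ∈ closure (annulus R)) : planeEquiv p ∈ closedComplexAnnulus R := by
  have hcl := (isCompact_closedComplexAnnulus R).isClosed.preimage planeEquiv.continuous
  have hsub : annulus R ⊆ planeEquiv ⁻¹' closedComplexAnnulus R := fun q hq =>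
    complexAnnulus_subset R ((planeEquiv_mem_complexAnnulus hR).2 hq)
  exact closure_minimal hsub hcl hp

theorem fderiv_fderiv_comp_planeEquiv {u : ℂ → ℝ} {p : ℝ × ℝ}
    (hu : ContDiffAt ℝ 2 u (planeEquiv p)) (v : ℝ × ℝ) :
    fderiv ℝ (fun q => fderiv ℝ (u ∘ planeEquiv) q v) p v =
      iteratedFDeriv ℝ 2 u (planeEquiv p) ![planeEquiv v, planeEquiv v] := by
  have h1 : (fun q => fderiv ℝ (u ∘ planeEquiv) q v) =
      (fun z => fderiv ℝ u z (planeEquiv v)) ∘ planeEquiv := by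
    ext q
    rw [planeEquiv.comp_right_fderiv]
    rfl
  have hd : DifferentiableAt ℝ (fderiv ℝ u) (planeEquiv p) :=
    (hu.fderiv_right (m := 1) (by norm_num)).differentiableAt one_ne_zero
  rw [h1, planeEquiv.comp_right_fderiv, iteratedFDeriv_two_apply]
  simp [fderiv_clm_apply hd (differentiableAt_const _)]

theorem harmonicOnAnnulus_comp_iff {R : ℝ} (hR : 1 < R) {u : ℂ → ℝ} :
    HarmonicOnAnnulus R (u ∘ planeEquiv) ↔ HarmonicOnNhd u (complexAnnulus R) := by
  have hcont : ContDiffOn ℝ 2 (u ∘ planeEquiv) (annulus R) ↔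
      ContDiffOn ℝ 2 u (complexAnnulus R) := by
    rw [← planeEquiv.contDiffOn_comp_iff]
    have : planeEquiv ⁻¹' complexAnnulus R = annulus R :=
      Set.ext fun p => planeEquiv_mem_complexAnnulus hR
    rw [this]
  have hlap : ContDiffOn ℝ 2 u (complexAnnulus R) → ∀ p ∈ annulus R,
      fderiv ℝ (fun q => fderiv ℝ (u ∘ planeEquiv) q (1, 0)) p (1, 0) +
      fderiv ℝ (fun q => fderiv ℝ (u ∘ planeEquiv) q (0, 1)) p (0, 1) =
        Laplacian.laplacian u (planeEquiv p) := by
    intro hu p hp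
    have hu' := hu.contDiffAt
      ((isOpen_complexAnnulus R).mem_nhds ((planeEquiv_mem_complexAnnulus hR).2 hp))
    have h1 : planeEquiv (1, 0) = 1 := planeEquiv_apply _
    have hI : planeEquiv (0, 1) = Complex.I := planeEquiv_apply _
    rw [fderiv_fderiv_comp_planeEquiv hu', fderiv_fderiv_comp_planeEquiv hu',
      laplacian_eq_iteratedFDeriv_complexPlane, h1, hI]
  constructor
  · rintro ⟨hc, hl⟩ z hz
    have hu := hcont.1 hc
    refine ⟨hu.contDiffAt ((isOpen_complexAnnulus R).mem_nhds hz), ?_⟩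
    filter_upwards [(isOpen_complexAnnulus R).mem_nhds hz] with w hw
    obtain ⟨p, rfl⟩ := planeEquiv.surjective w
    have hp := (planeEquiv_mem_complexAnnulus hR).1 hw
    rw [← hlap hu p hp, hl p hp, Pi.zero_apply]
  · intro hu
    refine ⟨hcont.2 hu.contDiffOn, fun p hp => ?_⟩
    rw [hlap hu.contDiffOn p hp]
    exact (hu _ ((planeEquiv_mem_complexAnnulus hR).2 hp)).2.self_of_nhds

theorem planeEquiv_cos_sin (θ : ℝ) :
    planeEquiv (Real.cos θ, Real.sin θ) = Complex.exp (θ * Complex.I) := by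
  rw [planeEquiv_apply]
  apply Complex.ext <;> simp [Complex.exp_ofReal_mul_I_re, Complex.exp_ofReal_mul_I_im]

theorem planeEquiv_mul_cos_sin (R θ : ℝ) :
    planeEquiv (R * Real.cos θ, R * Real.sin θ) = R * Complex.exp (θ * Complex.I) := by
  rw [planeEquiv_apply]
  apply Complex.ext <;> simp [Complex.exp_ofReal_mul_I_re, Complex.exp_ofReal_mul_I_im]

theorem HarmonicOnNhd.comp_conj {u : ℂ → ℝ} {U : Set ℂ} (hU : IsOpen U)
    (hconj : ∀ z ∈ U, (starRingEnd ℂ) z ∈ U) (hu : HarmonicOnNhd u U) :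
    HarmonicOnNhd (fun z => u ((starRingEnd ℂ) z)) U := by
  intro z hz
  obtain ⟨r, hr, hball⟩ := Metric.isOpen_iff.1 hU _ (hconj z hz)
  obtain ⟨F, hF, hFu⟩ := (hu.mono hball).exists_analyticOnNhd_ball_re_eq
  have hG : AnalyticAt ℂ ((starRingEnd ℂ) ∘ F ∘ (starRingEnd ℂ)) z := by
    have hd : DifferentiableOn ℂ ((starRingEnd ℂ) ∘ F ∘ (starRingEnd ℂ)) (ball z r) := by
      intro w hw
      have hw' : (starRingEnd ℂ) w ∈ ball ((starRingEnd ℂ) z) r := by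
        rw [mem_ball_iff_norm] at hw ⊢
        rwa [← map_sub, RCLike.norm_conj]
      have := (hF _ hw').differentiableAt.conj_conj
      rw [Complex.conj_conj] at this
      exact this.differentiableWithinAt
    exact hd.analyticAt (ball_mem_nhds z hr)
  refine (harmonicAt_congr_nhds ?_).2 hG.harmonicAt_re
  filter_upwards [ball_mem_nhds z hr] with w hw
  have : (starRingEnd ℂ) w ∈ ball ((starRingEnd ℂ) z) r := by
    rw [mem_ball_iff_norm] at hw ⊢
    rwa [← map_sub, RCLike.norm_conj]
  simpa using (hFu this).symm

namespace IsDirichletSolution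

variable {R : ℝ} {f g : ℝ → ℝ} {u : ℂ → ℝ}

theorem neg (h : IsDirichletSolution R f g u) : IsDirichletSolution R (-f) (-g) (-u) where
  continuousOn := h.continuousOn.neg
  harmonicOnNhd := h.harmonicOnNhd.neg
  inner_eq θ := by simp [h.inner_eq]
  outer_eq θ := by simp [h.outer_eq]

theorem comp_conj (h : IsDirichletSolution R f g u) :
    IsDirichletSolution R (fun θ => f (-θ)) (fun θ => g (-θ))
      (fun z => u ((starRingEnd ℂ) z)) where
  continuousOn := h.continuousOn.comp Complex.continuous_conj.continuousOn
    fun z hz => by simpa [closedComplexAnnulus] using hz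
  harmonicOnNhd := HarmonicOnNhd.comp_conj (isOpen_complexAnnulus R)
    (fun z hz => by simpa [complexAnnulus] using hz) h.harmonicOnNhd
  inner_eq θ := by simp [← h.inner_eq, ← Complex.exp_conj]
  outer_eq θ := by simp [← h.outer_eq, ← Complex.exp_conj]

/-- For odd boundary data the solution is antisymmetric. -/
theorem conj_eq_neg (h : IsDirichletSolution R f g u) (hf : ∀ θ, f (-θ) = -f θ)
    (hg : ∀ θ, g (-θ) = -g θ) : ∀ z ∈ closedComplexAnnulus R, u ((starRingEnd ℂ) z) = -u z := by
  have hc := h.comp_conj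
  rw [funext hf, funext hg] at hc
  exact hc.eqOn h.neg

/-- Comparison with the explicit harmonic function `K * Im (a * z - b / z)` on the upper half of
the annulus, where `a = 1 / (R + 1)` and `b = R / (R + 1)`. -/
theorem le_of_im_nonneg (hR : 1 < R) {K : ℝ} (hK : 0 ≤ K) (h : IsDirichletSolution R f g u)
    (hreal : ∀ z ∈ closedComplexAnnulus R, z.im = 0 → u z = 0)
    (hf : ∀ θ, f θ ≤ K * |Real.sin θ|) (hg : ∀ θ, g θ ≤ K * |Real.sin θ|) {z : ℂ}
    (hz : z ∈ closedComplexAnnulus R) (him : 0 ≤ z.im) : u z ≤ K * z.im / ‖z‖ := by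
  have hR0 : 0 < R := by linarith
  have hne : ∀ w ∈ closedComplexAnnulus R, w ≠ 0 := fun w hw h0 => by
    have := hw.1
    simp [h0] at this
    linarith
  set H : ℂ → ℝ := fun w => (K * (w / (R + 1) - R / (R + 1) / w) : ℂ).im with hH
  have hHeq : ∀ w ∈ closedComplexAnnulus R,
      H w = K * w.im * ((1 + R / ‖w‖ ^ 2) / (R + 1)) := by
    intro w hw
    have hn : 0 < ‖w‖ := norm_pos_iff.2 (hne w hw)
    have e : (K * (w / (R + 1) - R / (R + 1) / w) : ℂ) =
        (K / (R + 1) : ℝ) * w - (K * R / (R + 1) : ℝ) * w⁻¹ := by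
      push_cast
      ring
    rw [hH]
    simp only [e, Complex.sub_im, Complex.im_ofReal_mul, Complex.inv_im, Complex.normSq_eq_norm_sq]
    field_simp
    ring
  have hHan : HarmonicOnNhd H (closedComplexAnnulus R) := fun w hw =>
    (AnalyticAt.harmonicAt_im (by
      have := hne w hw
      have : (R : ℂ) + 1 ≠ 0 := by exact_mod_cast (by linarith : R + 1 ≠ 0)
      fun_prop (disch := assumption)))
  have hcl : IsClosed {w : ℂ | 0 ≤ w.im} := isClosed_le continuous_const Complex.continuous_im
  have hop : IsOpen {w : ℂ | 0 < w.im} := isOpen_lt continuous_const Complex.continuous_im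
  have hmax : u z - H z ≤ 0 := by
    refine nonpos_of_harmonicOnNhd (f := fun w => u w - H w)
      ((isCompact_closedComplexAnnulus R).inter_right hcl)
      ((isOpen_complexAnnulus R).inter hop)
      (Set.inter_subset_inter (complexAnnulus_subset R) fun w (hw : 0 < w.im) => hw.le)
      ((h.continuousOn.sub hHan.continuousOn).mono Set.inter_subset_left)
      (fun w hw => (h.harmonicOnNhd w hw.1).sub (hHan w (complexAnnulus_subset R hw.1)))
      ?_ z ⟨hz, him⟩
    rintro w ⟨⟨hw, hwim⟩, hw'⟩
    rcases (show 0 ≤ w.im from hwim).eq_or_lt with h0 | h0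
    · simp [hreal w hw h0.symm, hHeq w hw, ← h0]
    have hwA : w ∈ closedComplexAnnulus R \ complexAnnulus R := ⟨hw, fun hA => hw' ⟨hA, h0⟩⟩
    simp only [sub_nonpos, hHeq w hw]
    rcases exists_exp_eq_of_mem_diff hwA with ⟨θ, rfl⟩ | ⟨θ, rfl⟩
    · rw [Complex.exp_ofReal_mul_I_im] at h0 ⊢
      have := hf θ
      rw [abs_of_pos h0] at this
      rw [h.inner_eq, Complex.norm_exp_ofReal_mul_I]
      convert this using 1
      field_simp
      ring
    · rw [Complex.im_ofReal_mul, Complex.exp_ofReal_mul_I_im] at h0 ⊢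
      have := hg θ
      rw [abs_of_pos (pos_of_mul_pos_right h0 hR0.le)] at this
      rw [h.outer_eq, norm_mul, Complex.norm_exp_ofReal_mul_I, Complex.norm_real,
        Real.norm_of_nonneg hR0.le]
      convert this using 1
      field_simp
  have hn : 0 < ‖z‖ := norm_pos_iff.2 (hne z hz)
  refine (sub_nonpos.1 hmax).trans ?_
  rw [hHeq z hz, div_eq_mul_inv _ ‖z‖]
  refine mul_le_mul_of_nonneg_left ?_ (mul_nonneg hK him)
  rw [inv_eq_one_div, div_le_div_iff₀ (by linarith) hn]
  have : (1 + R / ‖z‖ ^ 2) * ‖z‖ = (‖z‖ ^ 2 + R) / ‖z‖ := by field_simp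
  rw [this, div_le_iff₀ hn]
  nlinarith [mul_nonneg (sub_nonneg.2 hz.1) (sub_nonneg.2 hz.2)]

theorem abs_le (hR : 1 < R) {K : ℝ} (hK : 0 ≤ K) (h : IsDirichletSolution R f g u)
    (hfodd : ∀ θ, f (-θ) = -f θ) (hgodd : ∀ θ, g (-θ) = -g θ)
    (hf : ∀ θ, |f θ| ≤ K * |Real.sin θ|) (hg : ∀ θ, |g θ| ≤ K * |Real.sin θ|) {z : ℂ}
    (hz : z ∈ closedComplexAnnulus R) : |u z| ≤ K * |z.im| / ‖z‖ := by
  have hanti := h.conj_eq_neg hfodd hgodd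
  have hreal : ∀ z ∈ closedComplexAnnulus R, z.im = 0 → u z = 0 := by
    intro w hw h0
    have := hanti w hw
    rw [Complex.conj_eq_iff_im.2 h0] at this
    linarith
  have upper : ∀ w ∈ closedComplexAnnulus R, 0 ≤ w.im → |u w| ≤ K * |w.im| / ‖w‖ := by
    intro w hw him
    rw [abs_of_nonneg him]
    refine abs_le'.2 ⟨?_, ?_⟩
    · exact h.le_of_im_nonneg hR hK hreal (fun θ => (le_abs_self _).trans (hf θ))
        (fun θ => (le_abs_self _).trans (hg θ)) hw him
    · exact h.neg.le_of_im_nonneg hR hK (fun w hw h0 => by simp [hreal w hw h0])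
        (fun θ => (neg_le_abs _).trans (hf θ)) (fun θ => (neg_le_abs _).trans (hg θ)) hw him
  rcases le_total 0 z.im with him | him
  · exact upper z hz him
  · have := upper ((starRingEnd ℂ) z) (by simpa [closedComplexAnnulus] using hz) (by simpa using him)
    simpa [hanti z hz] using this

end IsDirichletSolution

/-- Proposition B.1 (harmonic interpolation of boundary data): for continuous,
2π-periodic, odd boundary functions `φ`, `φ̂` dominated by `K|sin ϑ|`, there is a unique
continuous function on the closed annulus, harmonic and antisymmetric inside, with the
given boundary values, and it satisfies `|Φ(ζ,ρ)| ≤ K|ρ|/√(ζ²+ρ²)` on `A_R`. -/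
theorem prop_B_1 (R K : ℝ) (hR : 1 < R) (hK : 0 < K)
    (φ φh : ℝ → ℝ) (hφc : Continuous φ) (hφhc : Continuous φh)
    (hφper : ∀ θ, φ (θ + 2 * Real.pi) = φ θ) (hφhper : ∀ θ, φh (θ + 2 * Real.pi) = φh θ)
    (hφodd : ∀ θ, φ (-θ) = -φ θ) (hφhodd : ∀ θ, φh (-θ) = -φh θ)
    (hφb : ∀ θ, |φ θ| ≤ K * |Real.sin θ|) (hφhb : ∀ θ, |φh θ| ≤ K * |Real.sin θ|) :
    ∃ Φ : ℝ × ℝ → ℝ,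
      ContinuousOn Φ (closure (annulus R)) ∧
      HarmonicOnAnnulus R Φ ∧
      (∀ p ∈ closure (annulus R), Φ (p.1, -p.2) = -Φ p) ∧
      (∀ θ : ℝ, Φ (Real.cos θ, Real.sin θ) = φ θ) ∧
      (∀ θ : ℝ, Φ (R * Real.cos θ, R * Real.sin θ) = φh θ) ∧
      (∀ p ∈ annulus R, |Φ p| ≤ K * |p.2| / Real.sqrt (p.1 ^ 2 + p.2 ^ 2)) ∧
      (∀ Φ' : ℝ × ℝ → ℝ, ContinuousOn Φ' (closure (annulus R)) →
        HarmonicOnAnnulus R Φ' →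
        (∀ θ : ℝ, Φ' (Real.cos θ, Real.sin θ) = φ θ) →
        (∀ θ : ℝ, Φ' (R * Real.cos θ, R * Real.sin θ) = φh θ) →
        ∀ p ∈ closure (annulus R), Φ' p = Φ p) := by
  obtain ⟨u, hu⟩ := exists_isDirichletSolution hR hφc hφhc hφper hφhper
  refine ⟨u ∘ planeEquiv, hu.continuousOn.comp planeEquiv.continuous.continuousOn
      fun p hp => planeEquiv_mem_of_mem_closure hR hp,
    (harmonicOnAnnulus_comp_iff hR).2 hu.harmonicOnNhd, fun p hp => ?_, fun θ => ?_, fun θ => ?_,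
    fun p hp => ?_, fun Φ' hc hh hi ho p hp => ?_⟩
  · have := hu.conj_eq_neg hφodd hφhodd _ (planeEquiv_mem_of_mem_closure hR hp)
    simp only [Function.comp, planeEquiv_apply] at this ⊢
    exact this
  · rw [Function.comp, planeEquiv_cos_sin, hu.inner_eq]
  · rw [Function.comp, planeEquiv_mul_cos_sin, hu.outer_eq]
  · rw [← norm_planeEquiv]
    have := hu.abs_le hR hK.le hφodd hφhodd hφb hφhb
      (planeEquiv_mem_of_mem_closure hR (subset_closure hp))
    simpa only [Function.comp, planeEquiv_apply] using this
  · have hC : IsCompact (closure (annulus R)) :=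
      ((isCompact_closedComplexAnnulus R).image planeEquiv.symm.continuous).of_isClosed_subset
        isClosed_closure fun q hq =>
          ⟨planeEquiv q, planeEquiv_mem_of_mem_closure hR hq, planeEquiv.symm_apply_apply q⟩
    have hsub : planeEquiv '' closure (annulus R) ⊆ closedComplexAnnulus R := by
      rintro _ ⟨q, hq, rfl⟩
      exact planeEquiv_mem_of_mem_closure hR hq
    have hcomp : (Φ' ∘ planeEquiv.symm) ∘ planeEquiv = Φ' := by
      ext q
      simp
    have heq := eqOn_of_harmonicOnNhd (f := Φ' ∘ planeEquiv.symm) (g := u)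
      (hC.image planeEquiv.continuous) (isOpen_complexAnnulus R)
      (fun z hz => ⟨planeEquiv.symm z, subset_closure ((planeEquiv_mem_complexAnnulus hR).1
        (by simpa using hz)), planeEquiv.apply_symm_apply z⟩)
      (hc.comp planeEquiv.symm.continuous.continuousOn (by
        rintro _ ⟨q, hq, rfl⟩
        simpa using hq))
      (hu.continuousOn.mono hsub)
      ((harmonicOnAnnulus_comp_iff hR).1 (by rwa [hcomp])) hu.harmonicOnNhd ?_
    · simpa using heq ⟨p, hp, rfl⟩
    · intro z hz
      rcases exists_exp_eq_of_mem_diff ⟨hsub hz.1, hz.2⟩ with ⟨θ, rfl⟩ | ⟨θ, rfl⟩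
      · rw [hu.inner_eq, ← hi, ← planeEquiv_cos_sin, Function.comp, planeEquiv.symm_apply_apply]
      · rw [hu.outer_eq, ← ho, ← planeEquiv_mul_cos_sin, Function.comp,
          planeEquiv.symm_apply_apply]
end
end
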